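/- Let Z be a PMM satisfying assumptions A1 and A2, and suppose Z is Harris recurrent. Then for all fixed l, s ≥ 1, almost surely lim_{t→∞} sup_{n ≥ t} ‖P(Y_{t:∞} ∈ · | X_{l:n}) − P(Y_{t:∞} ∈ · | X_{s:n})‖_TV = 0, where the conditional distributions of Y_{t:∞} are regular versions on the cylindrical σ-algebra of Y^∞ and ‖·‖_TV is the total variation distance between these measures. -/

import Mathlib

open MeasureTheory ProbabilityTheory ENNReal

namespace PMMPaper

/-! ### General Markov chain notions (general state space) -/

section Kernels

variable {S : Type*} [MeasurableSpace S]

open Classical in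
/-- `kpow κ k` is the `k`-step transition kernel of a Markov chain with one-step kernel `κ`. -/
noncomputable def kpow (κ : Kernel S S) : ℕ → Kernel S S
  | 0 => Kernel.id
  | n + 1 => kpow κ n ∘ₖ κ

/-- `φ` is an irreducibility measure for the chain with kernel `κ`:
`φ(A) > 0` implies that from every point `z` some `k`-step transition reaches `A`
with positive probability. -/
def IsIrreducibilityMeasure (κ : Kernel S S) (φ : Measure S) : Prop :=
  ∀ A : Set S, MeasurableSet A → 0 < φ A → ∀ z : S, ∃ k : ℕ, 1 ≤ k ∧ 0 < kpow κ k z A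

/-- `ψ` is a maximal irreducibility measure: a σ-finite irreducibility measure dominating
every other σ-finite irreducibility measure. -/
def IsMaxIrreducibilityMeasure (κ : Kernel S S) (ψ : Measure S) : Prop :=
  SigmaFinite ψ ∧ IsIrreducibilityMeasure κ ψ ∧
    ∀ φ : Measure S, SigmaFinite φ → IsIrreducibilityMeasure κ φ → φ ≪ ψ

/-- `Pz` is the family of laws (on the path space `ℕ → S`) of the Markov chain with
transition kernel `κ` started at the point `z`:  `Pz z` is a probability measure under which
the coordinate process starts at `z` and is Markov with kernel `κ`. -/
def IsMarkovFamily (κ : Kernel S S) (Pz : S → Measure (ℕ → S)) : Prop :=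
  (∀ z : S, IsProbabilityMeasure (Pz z)) ∧
  (∀ z : S, Pz z {ω | ω 0 = z} = 1) ∧
  ∀ (z : S) (n : ℕ) (g : S → ℝ≥0∞), Measurable g → ∀ C : Set (ℕ → S),
    MeasurableSet[⨆ i ∈ Set.Iic n, MeasurableSpace.comap (fun ω : ℕ → S => ω i) inferInstance] C →
    ∫⁻ ω in C, g (ω (n + 1)) ∂(Pz z) = ∫⁻ ω in C, ∫⁻ z', g z' ∂(κ (ω n)) ∂(Pz z)

/-- Harris recurrence property (relative to the measure `ψ`): every set charged by `ψ` is
visited infinitely often, almost surely, from every starting point. -/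
def HarrisProp (κ : Kernel S S) (Pz : S → Measure (ℕ → S)) (ψ : Measure S) : Prop :=
  ∀ A : Set S, MeasurableSet A → 0 < ψ A → ∀ z : S,
    Pz z {ω | ∀ N : ℕ, ∃ k : ℕ, N ≤ k ∧ ω k ∈ A} = 1

/-- `π` is an invariant measure for the kernel `κ`. -/
def IsInvariantMeasure (κ : Kernel S S) (π : Measure S) : Prop :=
  π.bind (fun z => κ z) = π

/-- The chain is positive: its transition kernel admits an invariant probability measure. -/
def IsPositive (κ : Kernel S S) : Prop :=
  ∃ π : Measure S, IsProbabilityMeasure π ∧ IsInvariantMeasure κ π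

/-- The process `Z` on `(Ω, P)` is a homogeneous Markov chain with transition kernel `κ`. -/
def IsMarkovChain {Ω : Type*} [MeasurableSpace Ω] (P : Measure Ω) (Z : ℕ → Ω → S)
    (κ : Kernel S S) : Prop :=
  (∀ k : ℕ, Measurable (Z k)) ∧
  ∀ (n : ℕ) (g : S → ℝ≥0∞), Measurable g → ∀ C : Set Ω,
    MeasurableSet[⨆ i ∈ Set.Iic n, MeasurableSpace.comap (Z i) inferInstance] C →
    ∫⁻ ω in C, g (Z (n + 1) ω) ∂P = ∫⁻ ω in C, ∫⁻ z', g z' ∂(κ (Z n ω)) ∂P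

/-- The process `Z : ℤ → Ω → S` on `(Ω, P)` is a (two-sided) homogeneous Markov chain
with transition kernel `κ`. -/
def IsMarkovChainZ {Ω : Type*} [MeasurableSpace Ω] (P : Measure Ω) (Z : ℤ → Ω → S)
    (κ : Kernel S S) : Prop :=
  (∀ k : ℤ, Measurable (Z k)) ∧
  ∀ (n : ℤ) (g : S → ℝ≥0∞), Measurable g → ∀ C : Set Ω,
    MeasurableSet[⨆ i ∈ Set.Iic n, MeasurableSpace.comap (Z i) inferInstance] C →
    ∫⁻ ω in C, g (Z (n + 1) ω) ∂P = ∫⁻ ω in C, ∫⁻ z', g z' ∂(κ (Z n ω)) ∂P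

/-- The reversed-time process of the two-sided chain `Z` is a Markov chain with kernel `κ'`. -/
def IsRevMarkovChainZ {Ω : Type*} [MeasurableSpace Ω] (P : Measure Ω) (Z : ℤ → Ω → S)
    (κ' : Kernel S S) : Prop :=
  ∀ (n : ℤ) (g : S → ℝ≥0∞), Measurable g → ∀ C : Set Ω,
    MeasurableSet[⨆ i ∈ Set.Ici n, MeasurableSpace.comap (Z i) inferInstance] C →
    ∫⁻ ω in C, g (Z (n - 1) ω) ∂P = ∫⁻ ω in C, ∫⁻ z', g z' ∂(κ' (Z n ω)) ∂P

/-- The two-sided process `Z` is stationary: all finite-dimensional distributions are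
invariant under time shifts. -/
def IsStationaryZ {Ω : Type*} [MeasurableSpace Ω] (P : Measure Ω) (Z : ℤ → Ω → S) : Prop :=
  ∀ (k : ℤ) (n : ℕ),
    P.map (fun ω => fun i : Fin n => Z (k + (i : ℕ)) ω) =
      P.map (fun ω => fun i : Fin n => Z ((i : ℕ) : ℤ) ω)

/-- First-coordinate projection `A_(1)` of a set of finite strings. -/
def proj1 {α : Type*} {R : ℕ} (A : Set (Fin (R + 1) → α)) : Set α :=
  (fun x => x 0) '' A

/-- The section `A(a) = {x_{2:r} : (a, x_{2:r}) ∈ A}`. -/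
def secSet {α : Type*} {R : ℕ} (A : Set (Fin (R + 1) → α)) (a : α) : Set (Fin R → α) :=
  {xr | Fin.cons a xr ∈ A}

end Kernels

/-! ### Pairwise Markov models -/

variable {𝓧 : Type*} [MeasurableSpace 𝓧] {𝓨 : Type*} [Fintype 𝓨] [DecidableEq 𝓨]
  [MeasurableSpace 𝓨] [MeasurableSingletonClass 𝓨] [Nonempty 𝓨]
  {Ω : Type*} [MeasurableSpace Ω]

/-- `Z` is a pairwise Markov model on `(Ω, P)`: a homogeneous Markov chain on `𝓧 × 𝓨`
whose transition kernel `κ` has density `q(z'|z)` with respect to `μ × count`, and whose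
initial distribution has density `p0` with respect to `μ × count`. -/
def IsPMM (P : Measure Ω) (Z : ℕ → Ω → 𝓧 × 𝓨) (κ : Kernel (𝓧 × 𝓨) (𝓧 × 𝓨))
    (μ : Measure 𝓧) (q : 𝓧 × 𝓨 → 𝓧 × 𝓨 → ℝ≥0∞) (p0 : 𝓧 × 𝓨 → ℝ≥0∞) : Prop :=
  IsProbabilityMeasure P ∧ IsMarkovChain P Z κ ∧ SigmaFinite μ ∧
  Measurable (Function.uncurry q) ∧ Measurable p0 ∧
  (∀ z : 𝓧 × 𝓨, (κ z : Measure (𝓧 × 𝓨)) =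
      (μ.prod Measure.count).withDensity (fun z' => q z' z)) ∧
  P.map (Z 0) = (μ.prod Measure.count).withDensity p0

/-- Two-sided version of `IsPMM`. -/
def IsPMMZ (P : Measure Ω) (Z : ℤ → Ω → 𝓧 × 𝓨) (κ : Kernel (𝓧 × 𝓨) (𝓧 × 𝓨))
    (μ : Measure 𝓧) (q : 𝓧 × 𝓨 → 𝓧 × 𝓨 → ℝ≥0∞) (p0 : 𝓧 × 𝓨 → ℝ≥0∞) : Prop :=
  IsProbabilityMeasure P ∧ IsMarkovChainZ P Z κ ∧ SigmaFinite μ ∧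
  Measurable (Function.uncurry q) ∧ Measurable p0 ∧
  (∀ z : 𝓧 × 𝓨, (κ z : Measure (𝓧 × 𝓨)) =
      (μ.prod Measure.count).withDensity (fun z' => q z' z)) ∧
  P.map (Z 0) = (μ.prod Measure.count).withDensity p0

/-- `pijD q x i j` is the conditional density
`p_{ij}(x_{1:r}) = p(x_{2:r}, y_r = j | x_1, y_1 = i)` (a string `x` of length `R+1`). -/
noncomputable def pijD (q : 𝓧 × 𝓨 → 𝓧 × 𝓨 → ℝ≥0∞) {R : ℕ} (x : Fin (R + 1) → 𝓧)
    (i j : 𝓨) : ℝ≥0∞ :=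
  ∑ y : Fin (R + 1) → 𝓨,
    (if y 0 = i ∧ y (Fin.last R) = j then
      ∏ k : Fin R, q (x k.succ, y k.succ) (x k.castSucc, y k.castSucc) else 0)

/-- `pmidD q x i t j` is the density `p(y_{t+1} = j, x_{2:r} | x_1, y_1 = i)`. -/
noncomputable def pmidD (q : 𝓧 × 𝓨 → 𝓧 × 𝓨 → ℝ≥0∞) {R : ℕ} (x : Fin (R + 1) → 𝓧)
    (i : 𝓨) (t : Fin (R + 1)) (j : 𝓨) : ℝ≥0∞ :=
  ∑ y : Fin (R + 1) → 𝓨,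
    (if y 0 = i ∧ y t = j then
      ∏ k : Fin R, q (x k.succ, y k.succ) (x k.castSucc, y k.castSucc) else 0)

/-- `pxD q x i = p(x_{2:r} | x_1, y_1 = i)`. -/
noncomputable def pxD (q : 𝓧 × 𝓨 → 𝓧 × 𝓨 → ℝ≥0∞) {R : ℕ} (x : Fin (R + 1) → 𝓧)
    (i : 𝓨) : ℝ≥0∞ :=
  ∑ j : 𝓨, pijD q x i j

/-- The set `Y⁺(x_{1:r}) = {(i,j) : p_{ij}(x_{1:r}) > 0}`. -/
def Yplus (q : 𝓧 × 𝓨 → 𝓧 × 𝓨 → ℝ≥0∞) {R : ℕ} (x : Fin (R + 1) → 𝓧) : Set (𝓨 × 𝓨) :=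
  {p : 𝓨 × 𝓨 | 0 < pijD q x p.1 p.2}

/-- Joint density `p(x_{1:r}, y_{1:r})` of `Z_{1:r}`, built from the initial density `p0`
and the transition density `q`. -/
noncomputable def jointD (p0 : 𝓧 × 𝓨 → ℝ≥0∞) (q : 𝓧 × 𝓨 → 𝓧 × 𝓨 → ℝ≥0∞) {R : ℕ}
    (x : Fin (R + 1) → 𝓧) (y : Fin (R + 1) → 𝓨) : ℝ≥0∞ :=
  p0 (x 0, y 0) * ∏ k : Fin R, q (x k.succ, y k.succ) (x k.castSucc, y k.castSucc)

/-- Density `p(x_{1:r})` of the observations `X_{1:r}`. -/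
noncomputable def pXD (p0 : 𝓧 × 𝓨 → ℝ≥0∞) (q : 𝓧 × 𝓨 → 𝓧 × 𝓨 → ℝ≥0∞) {R : ℕ}
    (x : Fin (R + 1) → 𝓧) : ℝ≥0∞ :=
  ∑ y : Fin (R + 1) → 𝓨, jointD p0 q x y

/-- The set `Y*(x_{1:r}) = {(y_1, y_r) : ∃ y_{2:r-1}, p(x_{1:r}, y_{1:r}) > 0}`. -/
def Ystar (p0 : 𝓧 × 𝓨 → ℝ≥0∞) (q : 𝓧 × 𝓨 → 𝓧 × 𝓨 → ℝ≥0∞) {R : ℕ}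
    (x : Fin (R + 1) → 𝓧) : Set (𝓨 × 𝓨) :=
  {p : 𝓨 × 𝓨 | ∃ y : Fin (R + 1) → 𝓨,
    y 0 = p.1 ∧ y (Fin.last R) = p.2 ∧ 0 < jointD p0 q x y}

/-- Assumption **A1**: there is `r = R + 1 > 1` and a set `E ⊆ 𝓧^r` on which
`Y⁺(x_{1:r}) = Y⁺` is constant, nonempty, and a product set. -/
def Assumption1 (q : 𝓧 × 𝓨 → 𝓧 × 𝓨 → ℝ≥0∞) {R : ℕ} (E : Set (Fin (R + 1) → 𝓧))
    (Yp : Set (𝓨 × 𝓨)) : Prop :=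
  1 ≤ R ∧ Yp.Nonempty ∧ (∀ x ∈ E, Yplus q x = Yp) ∧
    Yp = (Prod.fst '' Yp) ×ˢ (Prod.snd '' Yp)

/-- Assumption **A2**: `ψ` is a maximal irreducibility measure for the chain,
`ψ(E_(1) × Y⁺_(1)) > 0` and `μ^{r-1}(E(x₁)) > 0` for all `x₁ ∈ E_(1)`. -/
def Assumption2 (κ : Kernel (𝓧 × 𝓨) (𝓧 × 𝓨)) (ψ : Measure (𝓧 × 𝓨)) (μ : Measure 𝓧)
    {R : ℕ} (E : Set (Fin (R + 1) → 𝓧)) (Yp : Set (𝓨 × 𝓨)) : Prop :=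
  IsMaxIrreducibilityMeasure κ ψ ∧
  0 < ψ (proj1 E ×ˢ (Prod.fst '' Yp)) ∧
  ∀ x₁ ∈ proj1 E, 0 < (Measure.pi fun _ : Fin R => μ) (secSet E x₁)

/-- Assumption **A1'** (stationary case): `Y*(x_{1:r}) = Y*` is constant on `E`,
nonempty and a product set. -/
def Assumption1' (p0 : 𝓧 × 𝓨 → ℝ≥0∞) (q : 𝓧 × 𝓨 → 𝓧 × 𝓨 → ℝ≥0∞) {R : ℕ}
    (E : Set (Fin (R + 1) → 𝓧)) (Ys : Set (𝓨 × 𝓨)) : Prop :=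
  1 ≤ R ∧ Ys.Nonempty ∧ (∀ x ∈ E, Ystar p0 q x = Ys) ∧
    Ys = (Prod.fst '' Ys) ×ˢ (Prod.snd '' Ys)

/-- Assumption **A2'**: `μ^r(E) > 0`. -/
def Assumption2' (μ : Measure 𝓧) {R : ℕ} (E : Set (Fin (R + 1) → 𝓧)) : Prop :=
  0 < (Measure.pi fun _ : Fin (R + 1) => μ) E

/-! ### Smoothing distributions -/

/-- The σ-algebra `σ(X_{l:n})` generated by the observations with indices in `[l, n]`. -/
noncomputable def obsSigma (Z : ℕ → Ω → 𝓧 × 𝓨) (l n : ℕ) : MeasurableSpace Ω :=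
  ⨆ i ∈ Set.Icc l n, MeasurableSpace.comap (fun ω => (Z i ω).1) inferInstance

/-- The σ-algebra `σ(X_{s:∞})` generated by the observations with indices `≥ s`. -/
noncomputable def obsSigmaFrom (Z : ℕ → Ω → 𝓧 × 𝓨) (s : ℕ) : MeasurableSpace Ω :=
  ⨆ i ∈ Set.Ici s, MeasurableSpace.comap (fun ω => (Z i ω).1) inferInstance

/-- The smoothing probability `ν^t_{l:n;m}(v) = P(Y_{t:t+m-1} = v | X_{l:n})`,
realized as a conditional expectation of an indicator. -/
noncomputable def smooth (P : Measure Ω) (Z : ℕ → Ω → 𝓧 × 𝓨) (t l n : ℕ) {m : ℕ}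
    (v : Fin m → 𝓨) : Ω → ℝ :=
  P[Set.indicator {ω | ∀ i : Fin m, (Z (t + (i : ℕ)) ω).2 = v i} (fun _ => (1 : ℝ)) |
    obsSigma Z l n]

/-- Total variation distance `‖ν^t_{l:n;m} − ν^t_{s:n;m}‖_TV`. -/
noncomputable def tvBlock (P : Measure Ω) (Z : ℕ → Ω → 𝓧 × 𝓨) (t l s n m : ℕ) (ω : Ω) : ℝ :=
  ∑ v : Fin m → 𝓨, |smooth P Z t l n v ω - smooth P Z t s n v ω|

/-- Two-sided version: the σ-algebra `σ(X_i ; i ∈ I)` for `I ⊆ ℤ`. -/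
noncomputable def obsSigmaZ (Z : ℤ → Ω → 𝓧 × 𝓨) (I : Set ℤ) : MeasurableSpace Ω :=
  ⨆ i ∈ I, MeasurableSpace.comap (fun ω => (Z i ω).1) inferInstance

/-- Two-sided smoothing probability `P(Y_{t:t+m-1} = v | X_i ; i ∈ I)`. -/
noncomputable def smoothZ (P : Measure Ω) (Z : ℤ → Ω → 𝓧 × 𝓨) (t : ℤ) (I : Set ℤ) {m : ℕ}
    (v : Fin m → 𝓨) : Ω → ℝ :=
  P[Set.indicator {ω | ∀ i : Fin m, (Z (t + (i : ℕ)) ω).2 = v i} (fun _ => (1 : ℝ)) |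
    obsSigmaZ Z I]

/-- Two-sided total variation distance between smoothing distributions with observation
index sets `I` and `J`. -/
noncomputable def tvBlockZ (P : Measure Ω) (Z : ℤ → Ω → 𝓧 × 𝓨) (t : ℤ) (I J : Set ℤ)
    (m : ℕ) (ω : Ω) : ℝ :=
  ∑ v : Fin m → 𝓨, |smoothZ P Z t I v ω - smoothZ P Z t J v ω|

/-! ### Counters, Doeblin matrices -/

/-- `κ_k(X_{s:t})`: the number of (almost non-overlapping) `E`-blocks of length `R+1`
in the observed string, counting from position `s + k` (paper's `κ_k`, `r' = R`). -/
noncomputable def kapCount (Z : ℕ → Ω → 𝓧 × 𝓨) {R : ℕ} (E : Set (Fin (R + 1) → 𝓧))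
    (s t kk : ℕ) (ω : Ω) : ℕ :=
  ∑ u ∈ Finset.range ((t - kk - s) / R),
    Set.indicator E (fun _ => 1) (fun i : Fin (R + 1) => (Z (u * R + s + kk + (i : ℕ)) ω).1)

/-- `κ̄(X_{s:t})`: the backward counter, counting `E`-blocks from position `t` backwards. -/
noncomputable def kapBar (Z : ℕ → Ω → 𝓧 × 𝓨) {R : ℕ} (E : Set (Fin (R + 1) → 𝓧))
    (s t : ℕ) (ω : Ω) : ℕ :=
  ∑ u ∈ Finset.range ((t - s) / R),
    Set.indicator E (fun _ => 1) (fun i : Fin (R + 1) => (Z (t - (u + 1) * R + (i : ℕ)) ω).1)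

open Classical in
/-- The segment `x_{a+1:b+1}` (0-based indices `a..b`) of a string of length `L+1`. -/
def segv {L : ℕ} (x : Fin (L + 1) → 𝓧) (a b : ℕ) (hab : a ≤ b) (hb : b ≤ L) :
    Fin (b - a + 1) → 𝓧 :=
  fun i => x ⟨a + (i : ℕ), by omega⟩

/-- Normalizing constant `c(x_{r:n}) = ∑_{j ∈ Y₂} p(x_{r+1:n} | x_r, y_r = j)`. -/
noncomputable def normC (q : 𝓧 × 𝓨 → 𝓧 × 𝓨 → ℝ≥0∞) (Y2 : Set 𝓨) {M : ℕ}
    (w : Fin (M + 1) → 𝓧) : ℝ≥0∞ :=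
  ∑ j : 𝓨, Set.indicator Y2 (fun j' => pxD q w j') j

/-- The probability vector `λ[x_{r:n}](j)`. -/
noncomputable def lamD (q : 𝓧 × 𝓨 → 𝓧 × 𝓨 → ℝ≥0∞) (Y2 : Set 𝓨) {M : ℕ}
    (w : Fin (M + 1) → 𝓧) (j : 𝓨) : ℝ≥0∞ :=
  Set.indicator Y2 (fun j' => pxD q w j') j / normC q Y2 w

/-- The matrix `U[x_{1:n}](i,j)`; a version of `P(Y_r = j | X_{1:n} = x_{1:n}, Y_1 = i)`. -/
noncomputable def UMat (q : 𝓧 × 𝓨 → 𝓧 × 𝓨 → ℝ≥0∞) (Y2 : Set 𝓨) {L R : ℕ} (hR : R ≤ L)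
    (x : Fin (L + 1) → 𝓧) (i j : 𝓨) : ℝ≥0∞ :=
  if 0 < pxD q x i then pmidD q x i ⟨R, by omega⟩ j / pxD q x i
  else lamD q Y2 (segv x R L hR (le_refl L)) j

/-! ### Total variation of measures, conditional laws of `Y_{t:∞}` -/

open Classical in
/-- Total variation distance between two measures (normalized as in the paper:
`‖P − Q‖_TV = 2 sup_A |P(A) − Q(A)|`). -/
noncomputable def tvDistM {W : Type*} [MeasurableSpace W] (ρ₁ ρ₂ : Measure W) : ℝ≥0∞ :=
  2 * ⨆ (A : Set W) (_ : MeasurableSet A), ((ρ₁ A - ρ₂ A) ⊔ (ρ₂ A - ρ₁ A))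

/-- The observation vector `X_{l:n}`. -/
def obsVec (Z : ℕ → Ω → 𝓧 × 𝓨) (l n : ℕ) (ω : Ω) : Fin (n + 1 - l) → 𝓧 :=
  fun i => (Z (l + (i : ℕ)) ω).1

/-- The tail signal process `Y_{t:∞}`. -/
def tailY (Z : ℕ → Ω → 𝓧 × 𝓨) (t : ℕ) (ω : Ω) : ℕ → 𝓨 :=
  fun k => (Z (t + k) ω).2

/-- The observation tail `X_{l:∞}`. -/
def obsTail (Z : ℕ → Ω → 𝓧 × 𝓨) (l : ℕ) (ω : Ω) : ℕ → 𝓧 :=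
  fun k => (Z (l + k) ω).1

/-- A regular version of the conditional distribution `P(Y_{t:∞} ∈ · | X_{l:n})`,
evaluated at `ω`. -/
noncomputable def condLawTail (P : Measure Ω) [IsFiniteMeasure P] (Z : ℕ → Ω → 𝓧 × 𝓨)
    (t l n : ℕ) (ω : Ω) : Measure (ℕ → 𝓨) :=
  condDistrib (tailY Z t) (obsVec Z l n) P (obsVec Z l n ω)

/-- A regular version of the conditional distribution `P(Y_{t:∞} ∈ · | X_{l:∞})`,
evaluated at `ω`. -/
noncomputable def condLawTailInf (P : Measure Ω) [IsFiniteMeasure P] (Z : ℕ → Ω → 𝓧 × 𝓨)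
    (t l : ℕ) (ω : Ω) : Measure (ℕ → 𝓨) :=
  condDistrib (tailY Z t) (obsTail Z l) P (obsTail Z l ω)

/-! ### Hidden Markov models and matrices -/

/-- Powers of a nonnegative matrix on `𝓨`. -/
noncomputable def matpow (p : 𝓨 → 𝓨 → ℝ≥0∞) : ℕ → 𝓨 → 𝓨 → ℝ≥0∞
  | 0 => fun i j => if i = j then 1 else 0
  | n + 1 => fun i j => ∑ k : 𝓨, matpow p n i k * p k j

/-- The sub-matrix `ℙ_C` of `p` with rows and columns restricted to `C` (and `0` outside). -/
noncomputable def subMat (p : 𝓨 → 𝓨 → ℝ≥0∞) (C : Set 𝓨) : 𝓨 → 𝓨 → ℝ≥0∞ :=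
  fun i j => Set.indicator (C ×ˢ C) (fun ij : 𝓨 × 𝓨 => p ij.1 ij.2) (i, j)

/-- Support `G_i = {x : f_i(x) > 0}` of the emission density `f_i`. -/
def emisSupp (f : 𝓨 → 𝓧 → ℝ≥0∞) (i : 𝓨) : Set 𝓧 :=
  {x | 0 < f i x}

/-- `C` is a cluster: `μ[(∩_{i∈C} G_i) \ (∪_{i∉C} G_i)] > 0`. -/
def IsCluster (μ : Measure 𝓧) (f : 𝓨 → 𝓧 → ℝ≥0∞) (C : Set 𝓨) : Prop :=
  0 < μ ((⋂ i ∈ C, emisSupp f i) \ (⋃ i ∈ Cᶜ, emisSupp f i))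


set_option linter.unusedSectionVars false

section HelperA

variable {S : Type*} [MeasurableSpace S] {Ω' : Type*} [MeasurableSpace Ω']

/-- history σ-algebra -/
abbrev FF (Z : ℕ → Ω' → S) (n : ℕ) : MeasurableSpace Ω' :=
  ⨆ i ∈ Set.Iic n, MeasurableSpace.comap (Z i) inferInstance

lemma FF_le {Z : ℕ → Ω' → S} (hZ : ∀ k, Measurable (Z k)) (n : ℕ) :
    FF Z n ≤ (inferInstance : MeasurableSpace Ω') :=
  iSup₂_le fun i _ => (hZ i).comap_le

lemma FF_mono (Z : ℕ → Ω' → S) {n m : ℕ} (h : n ≤ m) : FF Z n ≤ FF Z m :=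
  biSup_mono fun _ hi => le_trans hi h

lemma FF_meas (Z : ℕ → Ω' → S) {i n : ℕ} (h : i ≤ n) : Measurable[FF Z n] (Z i) := by
  rw [measurable_iff_comap_le]
  exact le_biSup (fun i => MeasurableSpace.comap (Z i) inferInstance) (Set.mem_Iic.2 h)

lemma family_chain {κ : Kernel S S} {Pz : S → Measure (ℕ → S)} (h : IsMarkovFamily κ Pz) (z : S) :
    IsMarkovChain (Pz z) (fun n (ω : ℕ → S) => ω n) κ :=
  ⟨fun k => measurable_pi_apply k, fun n g hg C hC => h.2.2 z n g hg C hC⟩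

lemma family_start [MeasurableSingletonClass S] {κ : Kernel S S} {Pz : S → Measure (ℕ → S)}
    (h : IsMarkovFamily κ Pz) (z : S) : ∀ᵐ ω ∂(Pz z), ω 0 = z := by
  have := h.1 z
  have hm : MeasurableSet {ω : ℕ → S | ω 0 = z} :=
    (measurable_pi_apply (X := fun _ : ℕ => S) 0) (measurableSet_singleton z)
  exact (prob_compl_eq_zero_iff hm).2 (h.2.1 z)

lemma family_markov [MeasurableSingletonClass S] {κ : Kernel S S} {Pz : S → Measure (ℕ → S)}
    (h : IsMarkovFamily κ Pz) : IsMarkovKernel κ := by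
  refine ⟨fun z => ⟨?_⟩⟩
  have := h.1 z
  have h1 := h.2.2 z 0 (fun _ => 1) measurable_const Set.univ MeasurableSet.univ
  simp only [Measure.restrict_univ, lintegral_const, measure_univ, one_mul] at h1
  have h2 : ∫⁻ ω, κ (ω 0) Set.univ ∂(Pz z) = ∫⁻ _, κ z Set.univ ∂(Pz z) := by
    refine lintegral_congr_ae ?_
    filter_upwards [family_start h z] with ω hω
    rw [hω]
  rw [h2] at h1
  simpa using h1.symm

/-- probability of not hitting `A` in the next `m` steps -/
noncomputable def nh (κ : Kernel S S) (A : Set S) : ℕ → S → ℝ≥0∞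
  | 0 => fun _ => 1
  | m + 1 => fun z => ∫⁻ z', Set.indicator Aᶜ (nh κ A m) z' ∂(κ z)

lemma nh_meas (κ : Kernel S S) {A : Set S} (hA : MeasurableSet A) (m : ℕ) :
    Measurable (nh κ A m) := by
  induction m with
  | zero => exact measurable_const
  | succ m ih => exact (ih.indicator hA.compl).lintegral_kernel

lemma nh_le_one (κ : Kernel S S) [IsMarkovKernel κ] (A : Set S) (m : ℕ) (z : S) :
    nh κ A m z ≤ 1 := by
  induction m generalizing z with
  | zero => exact le_rfl
  | succ m ih =>
    calc nh κ A (m + 1) z ≤ ∫⁻ _, 1 ∂(κ z) := by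
          refine lintegral_mono fun z' => ?_
          exact (Set.indicator_le_self _ _ _).trans (ih z')
      _ = 1 := by simp

lemma nh_eq {P : Measure Ω'} {Z : ℕ → Ω' → S} {κ : Kernel S S} (hM : IsMarkovChain P Z κ)
    {A : Set S} (hA : MeasurableSet A) (m : ℕ) : ∀ (N : ℕ) (C : Set Ω'), MeasurableSet[FF Z N] C →
    P (C ∩ {ω | ∀ k, N < k → k ≤ N + m → Z k ω ∉ A}) = ∫⁻ ω in C, nh κ A m (Z N ω) ∂P := by
  induction m with
  | zero =>
    intro N C hC
    have : {ω | ∀ k, N < k → k ≤ N + 0 → Z k ω ∉ A} = Set.univ := by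
      ext ω; simp only [Set.mem_ofPred_eq, Set.mem_univ, iff_true]; intro k h1 h2; omega
    rw [this]; simp [nh]
  | succ m ih =>
    intro N C hC
    have hC' : MeasurableSet[FF Z (N+1)] (C ∩ (Z (N+1)) ⁻¹' Aᶜ) :=
      MeasurableSet.inter (FF_mono Z (Nat.le_succ N) _ hC)
        (FF_meas Z (le_refl (N+1)) hA.compl)
    have hset : C ∩ {ω | ∀ k, N < k → k ≤ N + (m+1) → Z k ω ∉ A} =
        (C ∩ (Z (N+1)) ⁻¹' Aᶜ) ∩ {ω | ∀ k, N+1 < k → k ≤ N + 1 + m → Z k ω ∉ A} := by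
      ext ω
      simp only [Set.mem_inter_iff, Set.mem_ofPred_eq, Set.mem_preimage, Set.mem_compl_iff]
      constructor
      · rintro ⟨h1, h2⟩
        exact ⟨⟨h1, h2 _ (by omega) (by omega)⟩, fun k hk hk' => h2 k (by omega) (by omega)⟩
      · rintro ⟨⟨h1, h2⟩, h3⟩
        refine ⟨h1, fun k hk hk' => ?_⟩
        rcases Nat.lt_or_ge (N+1) k with h | h
        · exact h3 k h (by omega)
        · have : k = N + 1 := by omega
          rwa [this]
    rw [hset, ih _ _ hC']
    have hg : Measurable (Set.indicator Aᶜ (nh κ A m)) := (nh_meas κ hA m).indicator hA.compl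
    rw [show nh κ A (m+1) = fun z => ∫⁻ z', Set.indicator Aᶜ (nh κ A m) z' ∂(κ z) from rfl]
    rw [← hM.2 N _ hg C hC, Set.inter_comm,
      ← Measure.restrict_restrict ((hM.1 (N+1)) hA.compl),
      ← lintegral_indicator ((hM.1 (N+1)) hA.compl)]
    rfl

lemma nh_tendsto [MeasurableSingletonClass S] {κ : Kernel S S} {Pz : S → Measure (ℕ → S)}
    (h : IsMarkovFamily κ Pz) {A : Set S} (hA : MeasurableSet A)
    (hH : ∀ z : S, Pz z {ω | ∀ N : ℕ, ∃ k : ℕ, N ≤ k ∧ ω k ∈ A} = 1) (z : S) :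
    Filter.Tendsto (fun m => nh κ A m z) Filter.atTop (nhds 0) := by
  have := h.1 z
  have hm : MeasurableSet {ω : ℕ → S | ∀ N : ℕ, ∃ k : ℕ, N ≤ k ∧ ω k ∈ A} := by
    have : {ω : ℕ → S | ∀ N : ℕ, ∃ k : ℕ, N ≤ k ∧ ω k ∈ A} =
      ⋂ N : ℕ, ⋃ k : ℕ, ⋃ _ : N ≤ k, (fun ω : ℕ → S => ω k) ⁻¹' A := by
      ext ω; simp
    rw [this]
    exact MeasurableSet.iInter fun N => MeasurableSet.iUnion fun k => MeasurableSet.iUnion fun _ =>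
      (measurable_pi_apply k) hA
  have h0 := (prob_compl_eq_zero_iff hm).2 (hH z)
  have heq : ∀ m, nh κ A m z =
      Pz z {ω | ∀ k, 0 < k → k ≤ 0 + m → ω k ∉ A} := by
    intro m
    have h1 := nh_eq (family_chain h z) hA m 0 Set.univ MeasurableSet.univ
    rw [Set.univ_inter] at h1
    rw [h1, Measure.restrict_univ]
    have h2 : ∫⁻ ω, nh κ A m (ω 0) ∂(Pz z) = ∫⁻ _, nh κ A m z ∂(Pz z) := by
      refine lintegral_congr_ae ?_
      filter_upwards [family_start h z] with ω hω
      rw [hω]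
    rw [h2]; simp
  simp_rw [heq]
  have hanti : Antitone fun m : ℕ => {ω : ℕ → S | ∀ k, 0 < k → k ≤ 0 + m → ω k ∉ A} := by
    intro a b hab ω hω k h1 h2
    exact hω k h1 (by omega)
  have := tendsto_measure_iInter_atTop (μ := Pz z)
    (s := fun m : ℕ => {ω : ℕ → S | ∀ k, 0 < k → k ≤ 0 + m → ω k ∉ A}) ?_ hanti
    ⟨0, measure_ne_top _ _⟩
  · have h3 : Pz z (⋂ m : ℕ, {ω : ℕ → S | ∀ k, 0 < k → k ≤ 0 + m → ω k ∉ A}) = 0 := by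
      refine measure_mono_null ?_ h0
      intro ω hω hc
      obtain ⟨k, hk, hkA⟩ := hc 1
      exact (Set.mem_iInter.1 hω k) k (by omega) (by omega) hkA
    rwa [h3] at this
  · intro m
    refine MeasurableSet.nullMeasurableSet ?_
    have : {ω : ℕ → S | ∀ k, 0 < k → k ≤ 0 + m → ω k ∉ A} =
      ⋂ k : ℕ, ⋂ _ : 0 < k, ⋂ _ : k ≤ 0 + m, (fun ω : ℕ → S => ω k) ⁻¹' Aᶜ := by
      ext ω; simp
    rw [this]
    exact MeasurableSet.iInter fun k => MeasurableSet.iInter fun _ => MeasurableSet.iInter fun _ =>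
      (measurable_pi_apply k) hA.compl

/-- the chain `Z` under `P` visits `A` infinitely often. -/
lemma visits_io [MeasurableSingletonClass S] {κ : Kernel S S} {Pz : S → Measure (ℕ → S)}
    (h : IsMarkovFamily κ Pz) {A : Set S} (hA : MeasurableSet A)
    (hH : ∀ z : S, Pz z {ω | ∀ N : ℕ, ∃ k : ℕ, N ≤ k ∧ ω k ∈ A} = 1)
    {P : Measure Ω'} [IsProbabilityMeasure P] {Z : ℕ → Ω' → S} (hM : IsMarkovChain P Z κ) :
    ∀ᵐ ω ∂P, ∀ N : ℕ, ∃ k : ℕ, N ≤ k ∧ Z k ω ∈ A := by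
  rw [ae_all_iff]
  intro N
  have := family_markov h
  have hlim : Filter.Tendsto (fun m => ∫⁻ ω, nh κ A m (Z N ω) ∂P) Filter.atTop (nhds 0) := by
    have := tendsto_lintegral_of_dominated_convergence (μ := P)
      (F := fun m ω => nh κ A m (Z N ω)) (f := fun _ => 0) (fun _ => 1)
      (fun m => (nh_meas κ hA m).comp (hM.1 N)) 
      (fun m => Filter.Eventually.of_forall fun ω => nh_le_one κ A m _)
      (by simp) (Filter.Eventually.of_forall fun ω => nh_tendsto h hA hH _)
    simpa using this
  have hle : ∀ m, P {ω | ¬ ∃ k : ℕ, N ≤ k ∧ Z k ω ∈ A} ≤ ∫⁻ ω, nh κ A m (Z N ω) ∂P := by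
    intro m
    have h1 := nh_eq hM hA m N Set.univ MeasurableSet.univ
    rw [Set.univ_inter, Measure.restrict_univ] at h1
    rw [← h1]
    refine measure_mono fun ω hω k hk _ hkA => hω ⟨k, hk.le, hkA⟩
  exact le_antisymm (ge_of_tendsto' hlim hle) bot_le

/-- the path up to time `n`, filled with `z0` afterwards. -/
def prep (z0 : S) (Z : ℕ → Ω' → S) (n : ℕ) (ω : Ω') : ℕ → S := fun a => if a ≤ n then Z a ω else z0

lemma prep_succ (z0 : S) (Z : ℕ → Ω' → S) (n : ℕ) (ω : Ω') :
    prep z0 Z (n+1) ω = Function.update (prep z0 Z n ω) (n+1) (Z (n+1) ω) := by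
  ext a
  by_cases h : a = n + 1
  · subst h; simp [prep]
  · rw [Function.update_of_ne h]
    simp only [prep]
    have : a ≤ n + 1 ↔ a ≤ n := by omega
    simp [this]

lemma prep_meas (z0 : S) (Z : ℕ → Ω' → S) (n : ℕ) : Measurable[FF Z n] (prep z0 Z n) := by
  refine @measurable_pi_lambda _ _ _ (FF Z n) _ _ fun a => ?_
  unfold prep
  by_cases h : a ≤ n
  · simp only [h, if_true]; exact FF_meas Z h
  · simp only [h, if_false]; exact @measurable_const _ _ _ (FF Z n) _

lemma meas_update (k : ℕ) : Measurable fun r : (ℕ → S) × S => Function.update r.1 k r.2 := by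
  refine measurable_pi_lambda _ fun a => ?_
  by_cases h : a = k
  · subst h; simpa using measurable_snd
  · simp only [Function.update_of_ne h]
    exact (measurable_pi_apply a).comp measurable_fst

lemma one_step (z0 : S) {P : Measure Ω'} [IsFiniteMeasure P] {Z : ℕ → Ω' → S} {κ : Kernel S S}
    [IsMarkovKernel κ] (hM : IsMarkovChain P Z κ) (n : ℕ) (J : (ℕ → S) → ℝ≥0∞) (hJ : Measurable J)
    (C : Set Ω') (hC : MeasurableSet[FF Z n] C) :
    ∫⁻ ω in C, J (prep z0 Z (n+1) ω) ∂P =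
      ∫⁻ ω in C, ∫⁻ z', J (Function.update (prep z0 Z n ω) (n+1) z') ∂(κ (Z n ω)) ∂P := by
  have hpm : Measurable (prep z0 Z n) := (prep_meas z0 Z n).mono (FF_le hM.1 n) le_rfl
  have hZm := hM.1 (n+1)
  have key : (P.restrict C).map (fun ω => (prep z0 Z n ω, Z (n+1) ω)) =
      ((P.restrict C).map (prep z0 Z n)) ⊗ₘ (κ.comap (fun p : ℕ → S => p n) (measurable_pi_apply n)) := by
    refine Measure.ext_prod fun {s t} hs ht => ?_
    rw [Measure.map_apply (hpm.prodMk hZm) (hs.prod ht), Measure.compProd_apply_prod hs ht,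
      setLIntegral_map hs (Kernel.measurable_coe _ ht) hpm]
    have hC' : MeasurableSet[FF Z n] (C ∩ prep z0 Z n ⁻¹' s) :=
      MeasurableSet.inter hC (prep_meas z0 Z n hs)
    have h1 := hM.2 n (t.indicator fun _ => 1) (measurable_const.indicator ht) _ hC'
    have h2 : (fun ω => t.indicator (fun _ => (1 : ℝ≥0∞)) (Z (n+1) ω)) =
      (Z (n+1) ⁻¹' t).indicator fun _ => 1 := rfl
    rw [h2, lintegral_indicator_const (hZm ht), one_mul] at h1
    simp_rw [lintegral_indicator_const ht, one_mul] at h1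
    rw [Measure.restrict_apply (hZm ht)] at h1
    rw [Measure.restrict_apply ((hpm.prodMk hZm) (hs.prod ht)),
      Measure.restrict_restrict (hpm hs), Set.inter_comm (prep z0 Z n ⁻¹' s)]
    have h3 : ∀ ω, (prep z0 Z n ω) n = Z n ω := fun ω => by simp [prep]
    simp only [Kernel.comap_apply, h3]
    rw [← h1]
    congr 1
    ext ω; simp; tauto
  have hJ' : Measurable fun r : (ℕ → S) × S => J (Function.update r.1 (n+1) r.2) :=
    hJ.comp (meas_update (n+1))
  have h4 : ∫⁻ r, J (Function.update r.1 (n+1) r.2)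
      ∂((P.restrict C).map (fun ω => (prep z0 Z n ω, Z (n+1) ω))) =
      ∫⁻ r, J (Function.update r.1 (n+1) r.2) ∂(((P.restrict C).map (prep z0 Z n)) ⊗ₘ
        (κ.comap (fun p : ℕ → S => p n) (measurable_pi_apply n))) := by rw [key]
  rw [lintegral_map hJ' (hpm.prodMk hZm), Measure.lintegral_compProd hJ',
    lintegral_map (hJ'.lintegral_kernel_prod_right' (κ := (κ.comap (fun p : ℕ → S => p n) (measurable_pi_apply n)))) hpm] at h4
  have h3 : ∀ ω, (prep z0 Z n ω) n = Z n ω := fun ω => by simp [prep]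
  simp only [Kernel.comap_apply, h3] at h4
  simp only [prep_succ]
  exact h4

end HelperA

section HelperB

/-- iterated integral over the coordinates `k, …, k+d-1`. -/
noncomputable def It (μ : Measure 𝓧) : ℕ → ℕ → ((ℕ → 𝓧) → ℝ≥0∞) → (ℕ → 𝓧) → ℝ≥0∞
  | 0, _, F => F
  | d + 1, k, F => fun x => ∫⁻ x', It μ d (k + 1) F (Function.update x k x') ∂μ

/-- backward recursion with terminal function `Ψ`. -/
noncomputable def Wf (q : 𝓧 × 𝓨 → 𝓧 × 𝓨 → ℝ≥0∞) (Ψ : (ℕ → 𝓧) → (ℕ → 𝓨) → ℝ≥0∞) :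
    ℕ → ℕ → (ℕ → 𝓧) → (ℕ → 𝓨) → ℝ≥0∞
  | 0, _ => Ψ
  | d + 1, k => fun x y =>
      ∑ j : 𝓨, q (x (k + 1), j) (x k, y k) * Wf q Ψ d (k + 1) x (Function.update y (k + 1) j)

lemma It_meas {μ : Measure 𝓧} [SFinite μ] {β : Type*} [MeasurableSpace β]
    {G : (ℕ → 𝓧) → β → ℝ≥0∞} (hG : Measurable (Function.uncurry G)) (d : ℕ) : ∀ k : ℕ,
    Measurable fun p : (ℕ → 𝓧) × β => It μ d k (fun x => G x p.2) p.1 := by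
  induction d with
  | zero => intro k; exact hG
  | succ d ih =>
    intro k
    have h1 : Measurable fun r : ((ℕ → 𝓧) × β) × 𝓧 =>
        ((Function.update r.1.1 k r.2, r.1.2) : (ℕ → 𝓧) × β) :=
      ((meas_update k).comp ((measurable_fst.comp measurable_fst).prodMk measurable_snd)).prodMk
        (measurable_snd.comp measurable_fst)
    have h2 := (ih (k+1)).comp h1
    exact h2.lintegral_prod_right' (ν := μ)

lemma It_meas' {μ : Measure 𝓧} [SFinite μ] {F : (ℕ → 𝓧) → ℝ≥0∞} (hF : Measurable F) (d k : ℕ) :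
    Measurable (It μ d k F) := by
  have h := It_meas (μ := μ) (β := Unit) (G := fun x _ => F x) (hF.comp measurable_fst) d k
  exact h.comp (measurable_id.prodMk measurable_const : Measurable fun x : ℕ → 𝓧 => (x, ()))

lemma It_sum {μ : Measure 𝓧} [SFinite μ] {F : 𝓨 → (ℕ → 𝓧) → ℝ≥0∞} (hF : ∀ j, Measurable (F j))
    (d : ℕ) : ∀ (k : ℕ) (x : ℕ → 𝓧),
    It μ d k (fun x => ∑ j, F j x) x = ∑ j, It μ d k (F j) x := by
  induction d with
  | zero => intro k x; rfl
  | succ d ih =>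
    intro k x
    simp only [It, ih]
    rw [lintegral_finsetSum]
    intro j _
    exact (It_meas' (hF j) d (k+1)).comp
      ((meas_update k).comp (measurable_const.prodMk measurable_id))

lemma It_mul {μ : Measure 𝓧} [SFinite μ] {F : (ℕ → 𝓧) → ℝ≥0∞} (hF : Measurable F)
    (c : (ℕ → 𝓧) → ℝ≥0∞) (d : ℕ) : ∀ (k : ℕ) (x : ℕ → 𝓧),
    (∀ x a x', k ≤ a → c (Function.update x a x') = c x) →
    It μ d k (fun x => c x * F x) x = c x * It μ d k F x := by
  induction d with
  | zero => intro k x _; rfl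
  | succ d ih =>
    intro k x hc
    simp only [It]
    have : ∀ x', It μ d (k+1) (fun x => c x * F x) (Function.update x k x') =
        c x * It μ d (k+1) F (Function.update x k x') := by
      intro x'
      rw [ih (k+1) _ (fun x a x' h => hc x a x' (by omega)), hc x k x' le_rfl]
    simp only [this]
    rw [lintegral_const_mul]
    exact (It_meas' hF d (k+1)).comp
      ((meas_update k).comp (measurable_const.prodMk measurable_id))

lemma It_congr {μ : Measure 𝓧} (F F' : (ℕ → 𝓧) → ℝ≥0∞) (k0 : ℕ)
    (h : ∀ x x' : ℕ → 𝓧, (∀ a, k0 ≤ a → x a = x' a) → F x = F' x') (d : ℕ) : ∀ (k : ℕ)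
    (x x' : ℕ → 𝓧), (∀ a, k0 ≤ a → x a = x' a) → It μ d k F x = It μ d k F' x' := by
  induction d with
  | zero => intro k x x' hx; exact h x x' hx
  | succ d ih =>
    intro k x x' hx
    refine lintegral_congr fun v => ih (k+1) _ _ fun a ha => ?_
    by_cases hak : a = k
    · subst hak; simp
    · simp [Function.update_of_ne hak, hx a ha]

lemma It_mono {μ : Measure 𝓧} {F F' : (ℕ → 𝓧) → ℝ≥0∞} (h : ∀ x, F x ≤ F' x) (d : ℕ) :
    ∀ (k : ℕ) (x : ℕ → 𝓧), It μ d k F x ≤ It μ d k F' x := by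
  induction d with
  | zero => intro k x; exact h x
  | succ d ih => intro k x; exact lintegral_mono fun v => ih _ _

lemma meas_updateY (k : ℕ) (j : 𝓨) :
    Measurable fun p : (ℕ → 𝓧) × (ℕ → 𝓨) => (p.1, Function.update p.2 k j) :=
  measurable_fst.prodMk ((meas_update k).comp (measurable_snd.prodMk measurable_const))

lemma Wf_meas {q : 𝓧 × 𝓨 → 𝓧 × 𝓨 → ℝ≥0∞} (hq : Measurable (Function.uncurry q))
    {Ψ : (ℕ → 𝓧) → (ℕ → 𝓨) → ℝ≥0∞} (hΨ : Measurable (Function.uncurry Ψ)) (d : ℕ) : ∀ k : ℕ,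
    Measurable (Function.uncurry (Wf q Ψ d k)) := by
  induction d with
  | zero => intro k; exact hΨ
  | succ d ih =>
    intro k
    refine Finset.measurable_sum _ fun j _ => Measurable.mul ?_ ?_
    · have : Measurable fun p : (ℕ → 𝓧) × (ℕ → 𝓨) =>
          (((p.1 (k+1), j), (p.1 k, p.2 k)) : (𝓧 × 𝓨) × (𝓧 × 𝓨)) := by fun_prop
      exact hq.comp this
    · exact (ih (k+1)).comp (meas_updateY (k+1) j)

lemma Wf_meas_x {q : 𝓧 × 𝓨 → 𝓧 × 𝓨 → ℝ≥0∞} (hq : Measurable (Function.uncurry q))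
    {Ψ : (ℕ → 𝓧) → (ℕ → 𝓨) → ℝ≥0∞} (hΨ : Measurable (Function.uncurry Ψ)) (d k : ℕ) (y : ℕ → 𝓨) :
    Measurable fun x => Wf q Ψ d k x y :=
  (Wf_meas hq hΨ d k).comp (measurable_id.prodMk measurable_const)

lemma Wf_mono {q : 𝓧 × 𝓨 → 𝓧 × 𝓨 → ℝ≥0∞} {Ψ Ψ' : (ℕ → 𝓧) → (ℕ → 𝓨) → ℝ≥0∞}
    (h : ∀ x y, Ψ x y ≤ Ψ' x y) (d : ℕ) : ∀ k x y, Wf q Ψ d k x y ≤ Wf q Ψ' d k x y := by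
  induction d with
  | zero => intro k x y; exact h x y
  | succ d ih =>
    intro k x y
    exact Finset.sum_le_sum fun j _ => mul_le_mul_right (ih _ _ _) _

lemma Wf_mul {q : 𝓧 × 𝓨 → 𝓧 × 𝓨 → ℝ≥0∞} {Ψ : (ℕ → 𝓧) → (ℕ → 𝓨) → ℝ≥0∞}
    (c : (ℕ → 𝓧) → ℝ≥0∞) (d : ℕ) : ∀ k x y,
    Wf q (fun x y => c x * Ψ x y) d k x y = c x * Wf q Ψ d k x y := by
  induction d with
  | zero => intro k x y; rfl
  | succ d ih =>
    intro k x y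
    simp only [Wf, ih, Finset.mul_sum]
    exact Finset.sum_congr rfl fun j _ => by ring

lemma Wf_congr {q : 𝓧 × 𝓨 → 𝓧 × 𝓨 → ℝ≥0∞} {Ψ : (ℕ → 𝓧) → (ℕ → 𝓨) → ℝ≥0∞} (t : ℕ)
    (d : ℕ) : ∀ (k : ℕ)
    (_ : ∀ x x' y y', (∀ a, k + d ≤ a → x a = x' a) → (∀ a, t ≤ a → y a = y' a) →
      Ψ x y = Ψ x' y')
    (x x' : ℕ → 𝓧) (y y' : ℕ → 𝓨), (∀ a, k ≤ a → x a = x' a) → y k = y' k →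
    (∀ a, t ≤ a → a ≤ k ∨ k + d < a → y a = y' a) →
    Wf q Ψ d k x y = Wf q Ψ d k x' y' := by
  induction d with
  | zero =>
    intro k h x x' y y' hx hk hy
    refine h x x' y y' hx fun a ha => hy a ha ?_
    omega
  | succ d ih =>
    intro k h x x' y y' hx hk hy
    refine Finset.sum_congr rfl fun j _ => ?_
    rw [hx (k+1) (by omega), hx k le_rfl, hk]
    congr 1
    refine ih (k+1) (fun x x' y y' h1 h2 => h x x' y y' (fun a ha => h1 a (by omega)) h2) _ _ _ _
      (fun a ha => hx a (by omega)) (by simp) ?_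
    intro a ha1 ha2
    by_cases hak : a = k + 1
    · subst hak; simp
    · simp only [Function.update_of_ne hak]
      exact hy a ha1 (by omega)

lemma It_Wf_swap {μ : Measure 𝓧} [SFinite μ] {q : 𝓧 × 𝓨 → 𝓧 × 𝓨 → ℝ≥0∞}
    (hq : Measurable (Function.uncurry q))
    {Ψ : (ℕ → 𝓧) → (ℕ → 𝓨) → ℝ≥0∞} (hΨ : Measurable (Function.uncurry Ψ)) (d k : ℕ)
    (x : ℕ → 𝓧) (y : ℕ → 𝓨) :
    It μ (d+1) (k+1) (fun x => Wf q Ψ (d+1) k x y) x =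
      ∫⁻ x', ∑ j : 𝓨, q (x', j) (x k, y k) *
        It μ d (k+2) (fun x => Wf q Ψ d (k+1) x (Function.update y (k+1) j))
          (Function.update x (k+1) x') ∂μ := by
  refine lintegral_congr fun x' => ?_
  simp only [Wf]
  have hqm : ∀ j, Measurable fun x : ℕ → 𝓧 => q (x (k+1), j) (x k, y k) := fun j =>
    hq.comp (show Measurable fun x : ℕ → 𝓧 =>
      (((x (k+1), j), (x k, y k)) : (𝓧 × 𝓨) × (𝓧 × 𝓨)) by fun_prop)
  refine (It_sum (F := fun j x => q (x (k+1), j) (x k, y k) *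
    Wf q Ψ d (k+1) x (Function.update y (k+1) j))
    (fun j => (hqm j).mul (Wf_meas_x hq hΨ _ _ _)) _ _ _).trans ?_
  refine Finset.sum_congr rfl fun j _ => ?_
  rw [It_mul (Wf_meas_x hq hΨ _ _ _) (fun x => q (x (k+1), j) (x k, y k))]
  · simp
  · intro x a x' ha
    rw [Function.update_of_ne (by omega), Function.update_of_ne (by omega)]

lemma kint {κ : Kernel (𝓧 × 𝓨) (𝓧 × 𝓨)} {μ : Measure 𝓧} [SFinite μ]
    {q : 𝓧 × 𝓨 → 𝓧 × 𝓨 → ℝ≥0∞} (hq : Measurable (Function.uncurry q))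
    (hκ : ∀ z : 𝓧 × 𝓨, (κ z : Measure (𝓧 × 𝓨)) =
      (μ.prod Measure.count).withDensity (fun z' => q z' z))
    (z : 𝓧 × 𝓨) {f : 𝓧 × 𝓨 → ℝ≥0∞} (hf : Measurable f) :
    ∫⁻ z', f z' ∂(κ z) = ∫⁻ x', ∑ j : 𝓨, q (x', j) z * f (x', j) ∂μ := by
  have hqz : Measurable fun z' => q z' z := hq.comp (measurable_id.prodMk measurable_const)
  rw [hκ z, lintegral_withDensity_eq_lintegral_mul _ hqz hf,
    lintegral_prod _ (hqz.mul hf).aemeasurable]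
  refine lintegral_congr fun x' => ?_
  rw [lintegral_count, tsum_fintype]
  rfl

lemma fst_update (p : ℕ → 𝓧 × 𝓨) (k : ℕ) (z : 𝓧 × 𝓨) :
    (fun a => (Function.update p k z a).1) = Function.update (fun a => (p a).1) k z.1 := by
  ext a; by_cases h : a = k
  · subst h; simp
  · simp [Function.update_of_ne h]

lemma snd_update (p : ℕ → 𝓧 × 𝓨) (k : ℕ) (z : 𝓧 × 𝓨) :
    (fun a => (Function.update p k z a).2) = Function.update (fun a => (p a).2) k z.2 := by
  ext a; by_cases h : a = k
  · subst h; simp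
  · simp [Function.update_of_ne h]

lemma S_step (z0 : 𝓧 × 𝓨) {P : Measure Ω} [IsFiniteMeasure P] {Z : ℕ → Ω → 𝓧 × 𝓨}
    {κ : Kernel (𝓧 × 𝓨) (𝓧 × 𝓨)} [IsMarkovKernel κ] {μ : Measure 𝓧} [SFinite μ]
    {q : 𝓧 × 𝓨 → 𝓧 × 𝓨 → ℝ≥0∞} (hq : Measurable (Function.uncurry q))
    (hκ : ∀ z : 𝓧 × 𝓨, (κ z : Measure (𝓧 × 𝓨)) =
      (μ.prod Measure.count).withDensity (fun z' => q z' z))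
    (hM : IsMarkovChain P Z κ)
    {Ψ : (ℕ → 𝓧) → (ℕ → 𝓨) → ℝ≥0∞} (hΨ : Measurable (Function.uncurry Ψ)) (d : ℕ) :
    ∀ (k : ℕ) (C : Set Ω), MeasurableSet[FF Z k] C →
    ∫⁻ ω in C, Ψ (fun a => (prep z0 Z (k+d) ω a).1) (fun a => (prep z0 Z (k+d) ω a).2) ∂P =
    ∫⁻ ω in C, It μ d (k+1) (fun x => Wf q Ψ d k x (fun a => (prep z0 Z k ω a).2))
      (fun a => (prep z0 Z k ω a).1) ∂P := by
  induction d with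
  | zero => intro k C hC; rfl
  | succ d ih =>
    intro k C hC
    have h1 := ih (k+1) C (FF_mono Z (Nat.le_succ k) _ hC)
    rw [show k + (d+1) = k + 1 + d by ring, h1]
    have hsplit : Measurable fun p : ℕ → 𝓧 × 𝓨 => ((fun a => (p a).1, fun a => (p a).2) :
        (ℕ → 𝓧) × (ℕ → 𝓨)) := by fun_prop
    have hJ0 : Measurable fun p : (ℕ → 𝓧) × (ℕ → 𝓨) =>
        It μ d (k+2) (fun x => Wf q Ψ d (k+1) x p.2) p.1 :=
      It_meas (Wf_meas hq hΨ d (k+1)) d (k+2)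
    have hJ := hJ0.comp hsplit
    have h2 := one_step z0 hM k _ hJ C hC
    refine h2.trans ?_
    refine lintegral_congr fun ω => ?_
    refine (kint hq hκ _ (hJ.comp ((meas_update (k+1)).comp
      ((measurable_const (a := prep z0 Z k ω)).prodMk measurable_id)))).trans ?_
    rw [It_Wf_swap hq hΨ]
    refine lintegral_congr fun x' => Finset.sum_congr rfl fun j _ => ?_
    have h3 : (prep z0 Z k ω k) = Z k ω := by simp [prep]
    simp only [Function.comp, fst_update, snd_update, h3, id]

lemma It_Wf_one {κ : Kernel (𝓧 × 𝓨) (𝓧 × 𝓨)} [IsMarkovKernel κ] {μ : Measure 𝓧} [SFinite μ]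
    {q : 𝓧 × 𝓨 → 𝓧 × 𝓨 → ℝ≥0∞} (hq : Measurable (Function.uncurry q))
    (hκ : ∀ z : 𝓧 × 𝓨, (κ z : Measure (𝓧 × 𝓨)) =
      (μ.prod Measure.count).withDensity (fun z' => q z' z)) (d : ℕ) : ∀ (k : ℕ)
    (x : ℕ → 𝓧) (y : ℕ → 𝓨), It μ d (k+1) (fun x => Wf q (fun _ _ => 1) d k x y) x = 1 := by
  induction d with
  | zero => intro k x y; rfl
  | succ d ih =>
    intro k x y
    rw [It_Wf_swap hq measurable_const]
    simp only [ih]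
    have := kint hq hκ (x k, y k) (f := fun _ => 1) measurable_const
    rw [← this]; simp

/-- overwrite the coordinates `k, …, k+d-1` of `x` by `v`. -/
def glue {d : ℕ} (k : ℕ) (x : ℕ → 𝓧) (v : Fin d → 𝓧) : ℕ → 𝓧 :=
  fun a => if h : k ≤ a ∧ a - k < d then v ⟨a - k, h.2⟩ else x a

lemma glue_meas {d : ℕ} (k : ℕ) (x : ℕ → 𝓧) : Measurable fun v : Fin d → 𝓧 => glue k x v := by
  refine measurable_pi_lambda _ fun a => ?_
  unfold glue
  by_cases h : k ≤ a ∧ a - k < d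
  · simp only [h, and_self, dif_pos]; exact measurable_pi_apply _
  · simp only [h, dif_neg, not_false_eq_true]; exact measurable_const

lemma glue_cons {d : ℕ} (k : ℕ) (x : ℕ → 𝓧) (x' : 𝓧) (v : Fin d → 𝓧) :
    glue k x (Fin.cons x' v : Fin (d+1) → 𝓧) = glue (k+1) (Function.update x k x') v := by
  ext a
  unfold glue
  rcases lt_trichotomy a k with h | h | h
  · rw [dif_neg (by omega), dif_neg (by omega), Function.update_of_ne (by omega)]
  · subst h
    rw [dif_pos (by omega), dif_neg (by omega), Function.update_self]
    have : (⟨a - a, by omega⟩ : Fin (d+1)) = 0 := by ext; simp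
    rw [this, Fin.cons_zero]
  · by_cases h2 : a - k < d + 1
    · rw [dif_pos (by omega), dif_pos (by omega)]
      have : (⟨a - k, by omega⟩ : Fin (d+1)) = Fin.succ ⟨a - (k+1), by omega⟩ := by
        ext; simp; omega
      rw [this, Fin.cons_succ]
    · rw [dif_neg (by omega), dif_neg (by omega), Function.update_of_ne (by omega)]

lemma It_eq_pi {μ : Measure 𝓧} [SigmaFinite μ] {F : (ℕ → 𝓧) → ℝ≥0∞} (hF : Measurable F)
    (d : ℕ) : ∀ (k : ℕ) (x : ℕ → 𝓧),
    It μ d k F x = ∫⁻ v : Fin d → 𝓧, F (glue k x v) ∂(Measure.pi fun _ => μ) := by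
  induction d with
  | zero =>
    intro k x
    rw [Measure.pi_of_empty, lintegral_dirac]
    simp only [It]
    congr 1
    ext a; simp [glue]
  | succ d ih =>
    intro k x
    have hmp := measurePreserving_piFinSuccAbove (fun _ : Fin (d+1) => μ) 0
    have hm : Measurable fun v : Fin (d+1) → 𝓧 => F (glue k x v) := hF.comp (glue_meas k x)
    rw [← (hmp.symm).lintegral_comp hm, lintegral_prod]
    · simp only [It]
      refine lintegral_congr fun x' => ?_
      rw [ih]
      refine lintegral_congr fun v => ?_
      rw [← glue_cons]
      congr 2
      ext a; simp [MeasurableEquiv.piFinSuccAbove, Fin.insertNthEquiv]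
    · exact (hm.comp (MeasurableEquiv.measurable _)).aemeasurable

end HelperB

section HelperC

/-- `g` is squeezed between two multiples of `b` whose gap is at most `δ`. -/
def Osc (b g : 𝓨 → ℝ≥0∞) (c d : ℝ) : Prop :=
  0 ≤ c ∧ 0 ≤ d ∧
    ∀ i, b i ≠ ∞ → ENNReal.ofReal c * b i ≤ g i ∧ g i ≤ ENNReal.ofReal d * b i

lemma osc_step {b g b' g' : 𝓨 → ℝ≥0∞} {M : 𝓨 → 𝓨 → ℝ≥0∞} {c d : ℝ}
    (hb : ∀ i, b i = ∑ j, M i j * b' j) (hg : ∀ i, g i = ∑ j, M i j * g' j)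
    (h : Osc b' g' c d) : Osc b g c d := by
  obtain ⟨hc, hd, h⟩ := h
  refine ⟨hc, hd, fun i hi => ?_⟩
  rw [hb] at hi
  have hfin : ∀ j, M i j * b' j ≠ ∞ := fun j hj => hi (ENNReal.sum_eq_top.2 ⟨j, Finset.mem_univ _, hj⟩)
  rw [hb, hg, Finset.mul_sum, Finset.mul_sum]
  have key : ∀ j, ENNReal.ofReal c * (M i j * b' j) ≤ M i j * g' j ∧
      M i j * g' j ≤ ENNReal.ofReal d * (M i j * b' j) := by
    intro j
    by_cases hM : M i j = 0
    · simp [hM]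
    · have hb' : b' j ≠ ∞ := fun hbj => hfin j (by rw [hbj, ENNReal.mul_top hM])
      obtain ⟨h1, h2⟩ := h j hb'
      constructor
      · calc ENNReal.ofReal c * (M i j * b' j) = M i j * (ENNReal.ofReal c * b' j) := by ring
          _ ≤ _ := by gcongr
      · calc M i j * g' j ≤ M i j * (ENNReal.ofReal d * b' j) := by gcongr
          _ = _ := by ring
  exact ⟨Finset.sum_le_sum fun j _ => (key j).1, Finset.sum_le_sum fun j _ => (key j).2⟩

lemma block_real {ι : Type*} (Y : Finset ι) (B g b : ι → ℝ) {K c d lam : ℝ} (hK : 1 ≤ K)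
    (hB : ∀ j ∈ Y, 1 / K ≤ B j ∧ B j ≤ K) (hb : ∀ j ∈ Y, 0 ≤ b j)
    (hg : ∀ j ∈ Y, c * b j ≤ g j ∧ g j ≤ d * b j) (hlam : lam * ∑ j ∈ Y, b j = ∑ j ∈ Y, g j)
    (hcl : c ≤ lam) (hld : lam ≤ d) :
    ((1 - 1 / K ^ 2) * c + 1 / K ^ 2 * lam) * ∑ j ∈ Y, B j * b j ≤ ∑ j ∈ Y, B j * g j ∧
    ∑ j ∈ Y, B j * g j ≤ ((1 - 1 / K ^ 2) * d + 1 / K ^ 2 * lam) * ∑ j ∈ Y, B j * b j := by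
  have hK0 : 0 < K := by linarith
  have hH : ∑ j ∈ Y, B j * b j ≤ K * ∑ j ∈ Y, b j := by
    rw [Finset.mul_sum]
    exact Finset.sum_le_sum fun j hj => mul_le_mul_of_nonneg_right (hB j hj).2 (hb j hj)
  have hHS : 1 / K ^ 2 * ∑ j ∈ Y, B j * b j ≤ 1 / K * ∑ j ∈ Y, b j := by
    calc 1 / K ^ 2 * ∑ j ∈ Y, B j * b j ≤ 1 / K ^ 2 * (K * ∑ j ∈ Y, b j) := by gcongr
      _ = _ := by field_simp
  have h1 : 1 / K * ((lam - c) * ∑ j ∈ Y, b j) ≤ ∑ j ∈ Y, B j * g j - c * ∑ j ∈ Y, B j * b j := by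
    rw [sub_mul, hlam, Finset.mul_sum, Finset.mul_sum, ← Finset.sum_sub_distrib,
      ← Finset.sum_sub_distrib, Finset.mul_sum]
    refine Finset.sum_le_sum fun j hj => ?_
    have := mul_le_mul_of_nonneg_right (hB j hj).1 (sub_nonneg.2 (hg j hj).1)
    linarith
  have h2 : 1 / K * ((d - lam) * ∑ j ∈ Y, b j) ≤ d * ∑ j ∈ Y, B j * b j - ∑ j ∈ Y, B j * g j := by
    rw [sub_mul, hlam, Finset.mul_sum, Finset.mul_sum, ← Finset.sum_sub_distrib,
      ← Finset.sum_sub_distrib, Finset.mul_sum]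
    refine Finset.sum_le_sum fun j hj => ?_
    have := mul_le_mul_of_nonneg_right (hB j hj).1 (sub_nonneg.2 (hg j hj).2)
    linarith
  have h3 := mul_le_mul_of_nonneg_left hHS (sub_nonneg.2 hcl)
  have h4 := mul_le_mul_of_nonneg_left hHS (sub_nonneg.2 hld)
  constructor <;> linarith

open Classical in
lemma osc_block {b g b' g' : 𝓨 → ℝ≥0∞} {M : 𝓨 → 𝓨 → ℝ≥0∞} {c d K : ℝ} (hK : 1 ≤ K)
    {Y1 Y2 : Set 𝓨} (hMp : ∀ i ∈ Y1, ∀ j ∈ Y2, ENNReal.ofReal (1 / K) ≤ M i j ∧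
      M i j ≤ ENNReal.ofReal K)
    (hM0 : ∀ i j, ¬ (i ∈ Y1 ∧ j ∈ Y2) → M i j = 0)
    (hb : ∀ i, b i = ∑ j, M i j * b' j) (hg : ∀ i, g i = ∑ j, M i j * g' j)
    (h : Osc b' g' c d) :
    ∃ c' d' : ℝ, d' - c' = (1 - 1 / K ^ 2) * (d - c) ∧ Osc b g c' d' := by
  obtain ⟨hc, hd, h⟩ := h
  have hK0 : 0 < K := by linarith
  have hε0 : 0 ≤ 1 - 1 / K ^ 2 := by
    have : 1 ≤ K ^ 2 := one_le_pow₀ hK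
    rw [sub_nonneg, div_le_one (by positivity)]; exact this
  have hout : ∀ i, i ∉ Y1 → b i = 0 ∧ g i = 0 := by
    intro i hi
    rw [hb, hg]
    constructor <;> exact Finset.sum_eq_zero fun j _ => by rw [hM0 i j (fun h => hi h.1), zero_mul]
  by_cases hvac : ∃ j ∈ Y2, b' j = ∞
  · obtain ⟨j, hj, hbj⟩ := hvac
    obtain ⟨c', d', e, hc', hd'⟩ : ∃ c' d' : ℝ, d' - c' = (1 - 1 / K ^ 2) * (d - c) ∧ 0 ≤ c' ∧ 0 ≤ d' :=
      ⟨(1 - 1 / K ^ 2) * c, (1 - 1 / K ^ 2) * d, by ring, by positivity, by positivity⟩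
    refine ⟨c', d', e, hc', hd', fun i hi => ?_⟩
    by_cases hi1 : i ∈ Y1
    · exfalso
      apply hi
      rw [hb]
      refine ENNReal.sum_eq_top.2 ⟨j, Finset.mem_univ _, ?_⟩
      rw [hbj, ENNReal.mul_top]
      have := (hMp i hi1 j hj).1
      intro h0
      rw [h0] at this
      have h' := ENNReal.ofReal_eq_zero.1 (le_antisymm this bot_le)
      have : 0 < 1 / K := by positivity
      linarith
    · obtain ⟨h1, h2⟩ := hout i hi1
      simp [h1, h2]
  push Not at hvac
  have hgf : ∀ j ∈ Y2, g' j ≠ ∞ := fun j hj =>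
    ((h j (hvac j hj)).2.trans_lt (ENNReal.mul_lt_top ENNReal.ofReal_lt_top
      (lt_top_iff_ne_top.2 (hvac j hj)))).ne
  set Y : Finset 𝓨 := Finset.univ.filter (· ∈ Y2) with hY
  have hmem : ∀ j, j ∈ Y ↔ j ∈ Y2 := by simp [hY]
  have hgr : ∀ j ∈ Y, c * (b' j).toReal ≤ (g' j).toReal ∧ (g' j).toReal ≤ d * (b' j).toReal := by
    intro j hj
    rw [hmem] at hj
    obtain ⟨h1, h2⟩ := h j (hvac j hj)
    constructor
    · have := ENNReal.toReal_mono (hgf j hj) h1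
      rwa [ENNReal.toReal_mul, ENNReal.toReal_ofReal hc] at this
    · have := ENNReal.toReal_mono (ENNReal.mul_ne_top ENNReal.ofReal_ne_top (hvac j hj)) h2
      rwa [ENNReal.toReal_mul, ENNReal.toReal_ofReal hd] at this
  -- the mean value
  obtain ⟨lam, hlam, hl⟩ : ∃ lam : ℝ, lam * ∑ j ∈ Y, (b' j).toReal = ∑ j ∈ Y, (g' j).toReal ∧
      ((c ≤ lam ∧ lam ≤ d) ∨ (lam = 0 ∧ ∀ j ∈ Y, b' j = 0)) := by
    by_cases hS : ∑ j ∈ Y, (b' j).toReal = 0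
    · have hz := (Finset.sum_eq_zero_iff_of_nonneg (fun j _ => ENNReal.toReal_nonneg)).1 hS
      refine ⟨0, ?_, Or.inr ⟨rfl, fun j hj => ?_⟩⟩
      · rw [zero_mul]
        symm
        refine Finset.sum_eq_zero fun j hj => ?_
        have := (hgr j hj).2
        rw [hz j hj, mul_zero] at this
        exact le_antisymm this ENNReal.toReal_nonneg
      · rcases (ENNReal.toReal_eq_zero_iff _).1 (hz j hj) with h0 | h0
        · exact h0
        · exact absurd h0 (hvac j ((hmem j).1 hj))
    · have hpos : 0 < ∑ j ∈ Y, (b' j).toReal :=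
        lt_of_le_of_ne (Finset.sum_nonneg fun j _ => ENNReal.toReal_nonneg) (Ne.symm hS)
      refine ⟨(∑ j ∈ Y, (g' j).toReal) / ∑ j ∈ Y, (b' j).toReal, by field_simp, Or.inl ⟨?_, ?_⟩⟩
      · rw [le_div_iff₀ hpos, Finset.mul_sum]
        exact Finset.sum_le_sum fun j hj => (hgr j hj).1
      · rw [div_le_iff₀ hpos, Finset.mul_sum]
        exact Finset.sum_le_sum fun j hj => (hgr j hj).2
  have hl0 : 0 ≤ lam := by rcases hl with h | h; exacts [hc.trans h.1, h.1.ge]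
  refine ⟨(1 - 1 / K ^ 2) * c + 1 / K ^ 2 * lam, (1 - 1 / K ^ 2) * d + 1 / K ^ 2 * lam, by ring,
    by positivity, by positivity, fun i hi => ?_⟩
  by_cases hi1 : i ∈ Y1
  swap
  · obtain ⟨h1, h2⟩ := hout i hi1
    simp [h1, h2]
  have hred : ∀ f : 𝓨 → ℝ≥0∞, (∀ j ∈ Y2, f j ≠ ∞) → ∑ j, M i j * f j =
      ENNReal.ofReal (∑ j ∈ Y, (M i j).toReal * (f j).toReal) := by
    intro f hf
    rw [ENNReal.ofReal_sum_of_nonneg (fun j _ => by positivity)]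
    rw [← Finset.sum_subset (Finset.subset_univ Y)]
    · refine Finset.sum_congr rfl fun j hj => ?_
      rw [hmem] at hj
      rw [ENNReal.ofReal_mul ENNReal.toReal_nonneg, ENNReal.ofReal_toReal, ENNReal.ofReal_toReal (hf j hj)]
      exact ((hMp i hi1 j hj).2.trans_lt ENNReal.ofReal_lt_top).ne
    · intro j _ hj
      rw [hmem] at hj
      rw [hM0 i j (fun h => hj h.2), zero_mul]
  rw [hb, hg, hred b' hvac, hred g' hgf, ← ENNReal.ofReal_mul (by positivity),
    ← ENNReal.ofReal_mul (by positivity)]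
  have hBr : ∀ j ∈ Y, 1 / K ≤ (M i j).toReal ∧ (M i j).toReal ≤ K := by
    intro j hj
    rw [hmem] at hj
    obtain ⟨h1, h2⟩ := hMp i hi1 j hj
    constructor
    · have := ENNReal.toReal_mono (h2.trans_lt ENNReal.ofReal_lt_top).ne h1
      rwa [ENNReal.toReal_ofReal (by positivity)] at this
    · have := ENNReal.toReal_mono ENNReal.ofReal_ne_top h2
      rwa [ENNReal.toReal_ofReal (by positivity)] at this
  rcases hl with ⟨hl1, hl2⟩ | ⟨-, hz⟩
  · obtain ⟨h1, h2⟩ := block_real Y (fun j => (M i j).toReal) (fun j => (g' j).toReal)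
      (fun j => (b' j).toReal) hK hBr (fun j _ => ENNReal.toReal_nonneg) hgr hlam hl1 hl2
    exact ⟨ENNReal.ofReal_le_ofReal h1, ENNReal.ofReal_le_ofReal h2⟩
  · have e1 : ∑ j ∈ Y, (M i j).toReal * (b' j).toReal = 0 :=
      Finset.sum_eq_zero fun j hj => by simp [hz j hj]
    have e2 : ∑ j ∈ Y, (M i j).toReal * (g' j).toReal = 0 :=
      Finset.sum_eq_zero fun j hj => by
        have h1 := (hgr j hj).2
        rw [hz j hj] at h1
        simp only [ENNReal.toReal_zero, mul_zero] at h1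
        rw [le_antisymm h1 ENNReal.toReal_nonneg, mul_zero]
    rw [e1, e2]; simp

/-- products of matrices. -/
noncomputable def Mp (M : ℕ → 𝓨 → 𝓨 → ℝ≥0∞) : ℕ → ℕ → 𝓨 → 𝓨 → ℝ≥0∞
  | 0, _ => fun i j => if i = j then 1 else 0
  | R + 1, k => fun i j => ∑ m, M k i m * Mp M R (k + 1) m j

lemma Mp_apply {M : ℕ → 𝓨 → 𝓨 → ℝ≥0∞} {b : ℕ → 𝓨 → ℝ≥0∞} {t : ℕ}
    (hb : ∀ k, k < t → ∀ i, b k i = ∑ j, M k i j * b (k+1) j) (R : ℕ) : ∀ k, k + R ≤ t → ∀ i,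
    b k i = ∑ j, Mp M R k i j * b (k + R) j := by
  induction R with
  | zero => intro k hk i; simp [Mp]
  | succ R ih =>
    intro k hk i
    rw [hb k (by omega)]
    simp only [Mp, Finset.sum_mul]
    rw [Finset.sum_comm]
    refine Finset.sum_congr rfl fun m _ => ?_
    rw [ih (k+1) (by omega), Finset.mul_sum, show k + 1 + R = k + (R + 1) by ring]
    exact Finset.sum_congr rfl fun j _ => by ring

lemma osc_down {M : ℕ → 𝓨 → 𝓨 → ℝ≥0∞} {b g : ℕ → 𝓨 → ℝ≥0∞} {t : ℕ}
    (hb : ∀ k, k < t → ∀ i, b k i = ∑ j, M k i j * b (k+1) j)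
    (hg : ∀ k, k < t → ∀ i, g k i = ∑ j, M k i j * g (k+1) j) {c d : ℝ} {k k' : ℕ} (hkk : k ≤ k')
    (hk' : k' ≤ t) (h : Osc (b k') (g k') c d) : Osc (b k) (g k) c d := by
  obtain ⟨e, rfl⟩ := Nat.exists_eq_add_of_le hkk
  exact osc_step (Mp_apply hb e k hk') (Mp_apply hg e k hk') h

/-- between `s` and `t` there are `N` disjoint good blocks of length `R`. -/
def Blocks (B : ℕ → Prop) (R : ℕ) : ℕ → ℕ → ℕ → Prop
  | 0, s, t => s ≤ t
  | N + 1, s, t => ∃ k, s ≤ k ∧ B k ∧ Blocks B R N (k + R) t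

lemma Blocks.le {B : ℕ → Prop} {R N : ℕ} : ∀ {s t : ℕ}, Blocks B R N s t → s ≤ t := by
  induction N with
  | zero => intro s t h; exact h
  | succ N ih => rintro s t ⟨k, h1, -, h2⟩; have := ih h2; omega

lemma exists_blocks {B : ℕ → Prop} {R : ℕ} (hB : ∀ N, ∃ k, N ≤ k ∧ B k) (N : ℕ) : ∀ s,
    ∃ T, ∀ t, T ≤ t → Blocks B R N s t := by
  induction N with
  | zero => intro s; exact ⟨s, fun t h => h⟩
  | succ N ih =>
    intro s
    obtain ⟨k, hk, hBk⟩ := hB s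
    obtain ⟨T, hT⟩ := ih (k + R)
    exact ⟨T, fun t ht => ⟨k, hk, hBk, hT t ht⟩⟩

lemma osc_blocks {M : ℕ → 𝓨 → 𝓨 → ℝ≥0∞} {b g : ℕ → 𝓨 → ℝ≥0∞} {t R : ℕ}
    (hb : ∀ k, k < t → ∀ i, b k i = ∑ j, M k i j * b (k+1) j)
    (hg : ∀ k, k < t → ∀ i, g k i = ∑ j, M k i j * g (k+1) j)
    (hgb : ∀ i, g t i ≤ b t i) {K : ℝ} (hK : 1 ≤ K) {Y1 Y2 : Set 𝓨} {B : ℕ → Prop}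
    (hB : ∀ k, k + R ≤ t → B k → (∀ i ∈ Y1, ∀ j ∈ Y2, ENNReal.ofReal (1 / K) ≤ Mp M R k i j ∧
      Mp M R k i j ≤ ENNReal.ofReal K) ∧ (∀ i j, ¬ (i ∈ Y1 ∧ j ∈ Y2) → Mp M R k i j = 0))
    (N : ℕ) : ∀ s, Blocks B R N s t →
    ∃ c d : ℝ, d - c = (1 - 1 / K ^ 2) ^ N ∧ Osc (b s) (g s) c d := by
  induction N with
  | zero =>
    intro s hs
    refine ⟨0, 1, by simp, osc_down hb hg hs le_rfl ⟨le_rfl, zero_le_one, fun i _ => ?_⟩⟩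
    simpa using hgb i
  | succ N ih =>
    rintro s ⟨k, hsk, hBk, hbl⟩
    have hkt := hbl.le
    obtain ⟨c, d, hcd, ho⟩ := ih _ hbl
    obtain ⟨h1, h2⟩ := hB k hkt hBk
    obtain ⟨c', d', hcd', ho'⟩ := osc_block hK h1 h2 (Mp_apply hb R k hkt) (Mp_apply hg R k hkt) ho
    refine ⟨c', d', ?_, osc_down hb hg hsk (by omega) ho'⟩
    rw [hcd', hcd, pow_succ]; ring

lemma osc_final {b g p : 𝓨 → ℝ≥0∞} {c d : ℝ} (h : Osc b g c d)
    (hfin : ∑ i, p i * b i ≠ ∞) :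
    ENNReal.ofReal c * ∑ i, p i * b i ≤ ∑ i, p i * g i ∧
      ∑ i, p i * g i ≤ ENNReal.ofReal d * ∑ i, p i * b i := by
  have := osc_step (b := fun _ : 𝓨 => ∑ i, p i * b i) (g := fun _ => ∑ i, p i * g i)
    (M := fun _ j => p j) (fun _ => rfl) (fun _ => rfl) h
  exact this.2.2 (Classical.arbitrary _) hfin

lemma pijD_eq_Mp (q : 𝓧 × 𝓨 → 𝓧 × 𝓨 → ℝ≥0∞) (x : ℕ → 𝓧) (R : ℕ) : ∀ (k : ℕ) (i j : 𝓨),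
    pijD q (fun a : Fin (R+1) => x (k + a)) i j =
      Mp (fun k i j => q (x (k+1), j) (x k, i)) R k i j := by
  induction R with
  | zero =>
    intro k i j
    simp only [pijD, Mp]
    rw [← (Equiv.funUnique (Fin 1) 𝓨).symm.sum_comp]
    simp only [Finset.univ_eq_empty, Finset.prod_empty]
    rw [Finset.sum_eq_single i]
    · simp
    · intro m _ hm; simp [hm]
    · simp
  | succ R ih =>
    intro k i j
    simp only [Mp, ← ih]
    simp only [pijD]
    rw [← (Fin.consEquiv (fun _ : Fin (R+2) => 𝓨)).sum_comp, Fintype.sum_prod_type]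
    simp only [Fin.consEquiv, Equiv.coe_fn_mk, Fin.prod_univ_succ (n := R), Fin.cons_zero,
      Fin.cons_succ, ← Fin.succ_last, Fin.castSucc_zero, Fin.castSucc_succ]
    rw [Finset.sum_eq_single i (by intro m _ hm; simp [hm]) (by simp)]
    simp only [Finset.mul_sum]
    rw [Finset.sum_comm]
    refine Finset.sum_congr rfl fun y _ => ?_
    rw [Finset.sum_eq_single (y 0) (by intro m _ hm; simp [Ne.symm hm]) (by simp)]
    by_cases h : y (Fin.last R) = j
    · simp [h, add_comm, add_left_comm]
    · simp [h]

lemma Wf_eq_Mp (q : 𝓧 × 𝓨 → 𝓧 × 𝓨 → ℝ≥0∞) (ψ : (ℕ → 𝓧) → ℝ≥0∞) (R : ℕ) : ∀ (k : ℕ)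
    (x : ℕ → 𝓧) (y : ℕ → 𝓨), Wf q (fun x _ => ψ x) R k x y =
      ψ x * ∑ j, Mp (fun k i j => q (x (k+1), j) (x k, i)) R k (y k) j := by
  induction R with
  | zero => intro k x y; simp [Wf, Mp]
  | succ R ih =>
    intro k x y
    simp only [Wf, ih, Mp, Function.update_self]
    rw [Finset.sum_comm, Finset.mul_sum]
    refine Finset.sum_congr rfl fun j _ => ?_
    rw [← Finset.mul_sum]; ring

end HelperC

section HelperD

/-- the good observation blocks with quantitative bounds. -/
def EK (q : 𝓧 × 𝓨 → 𝓧 × 𝓨 → ℝ≥0∞) (R : ℕ) (Yp : Set (𝓨 × 𝓨)) (K : ℕ) : Set (Fin (R+1) → 𝓧) :=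
  {x | ∀ i j, ((i, j) ∈ Yp → ENNReal.ofReal (1 / ((K : ℝ) + 1)) ≤ pijD q x i j ∧
    pijD q x i j ≤ ENNReal.ofReal ((K : ℝ) + 1)) ∧ ((i, j) ∉ Yp → pijD q x i j = 0)}

lemma pijD_meas {q : 𝓧 × 𝓨 → 𝓧 × 𝓨 → ℝ≥0∞} (hq : Measurable (Function.uncurry q)) {R : ℕ}
    (i j : 𝓨) : Measurable fun x : Fin (R+1) → 𝓧 => pijD q x i j := by
  unfold pijD
  refine Finset.measurable_sum _ fun y _ => ?_
  by_cases h : y 0 = i ∧ y (Fin.last R) = j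
  · simp only [h, and_self, if_true]
    refine Finset.measurable_prod _ fun k _ => ?_
    exact hq.comp (show Measurable fun x : Fin (R+1) → 𝓧 =>
      (((x k.succ, y k.succ), (x k.castSucc, y k.castSucc)) : (𝓧 × 𝓨) × (𝓧 × 𝓨)) by fun_prop)
  · simp only [h, if_false]; exact measurable_const

lemma EK_meas {q : 𝓧 × 𝓨 → 𝓧 × 𝓨 → ℝ≥0∞} (hq : Measurable (Function.uncurry q)) (R : ℕ)
    (Yp : Set (𝓨 × 𝓨)) (K : ℕ) : MeasurableSet (EK q R Yp K) := by
  have : EK q R Yp K = ⋂ i, ⋂ j, {x | ((i, j) ∈ Yp → ENNReal.ofReal (1 / ((K : ℝ) + 1)) ≤ pijD q x i j ∧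
    pijD q x i j ≤ ENNReal.ofReal ((K : ℝ) + 1)) ∧ ((i, j) ∉ Yp → pijD q x i j = 0)} := by
    ext x; simp [EK]
  rw [this]
  refine MeasurableSet.iInter fun i => MeasurableSet.iInter fun j => ?_
  have hm := pijD_meas hq (R := R) i j
  by_cases h : (i, j) ∈ Yp
  · simp only [h, true_imp_iff, not_true, false_imp_iff, and_true]
    exact (measurableSet_le measurable_const hm).inter (measurableSet_le hm measurable_const)
  · simp only [h, false_imp_iff, not_false_eq_true, true_imp_iff, true_and]
    exact hm (measurableSet_singleton 0)

/-- conditional probability of a good block. -/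
noncomputable def betaK (μ : Measure 𝓧) (q : 𝓧 × 𝓨 → 𝓧 × 𝓨 → ℝ≥0∞) (R : ℕ) (Yp : Set (𝓨 × 𝓨))
    (K : ℕ) (z : 𝓧 × 𝓨) : ℝ≥0∞ :=
  ∫⁻ v : Fin R → 𝓧, (EK q R Yp K).indicator (fun _ => 1) (Fin.cons z.1 v) *
    ∑ j, pijD q (Fin.cons z.1 v : Fin (R+1) → 𝓧) z.2 j ∂(Measure.pi fun _ => μ)

lemma meas_cons (R : ℕ) : Measurable fun p : 𝓧 × (Fin R → 𝓧) =>
    (Fin.cons p.1 p.2 : Fin (R+1) → 𝓧) := by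
  refine measurable_pi_lambda _ fun a => ?_
  refine Fin.cases ?_ (fun a => ?_) a
  · simpa using measurable_fst
  · simp only [Fin.cons_succ]; fun_prop

lemma betaK_meas {μ : Measure 𝓧} [SigmaFinite μ] {q : 𝓧 × 𝓨 → 𝓧 × 𝓨 → ℝ≥0∞}
    (hq : Measurable (Function.uncurry q)) (R : ℕ) (Yp : Set (𝓨 × 𝓨)) (K : ℕ) :
    Measurable (betaK μ q R Yp K) := by
  refine measurable_from_prod_countable_left fun i => ?_
  have h : Measurable fun p : 𝓧 × (Fin R → 𝓧) =>
      (EK q R Yp K).indicator (fun _ => (1 : ℝ≥0∞)) (Fin.cons p.1 p.2) *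
    ∑ j, pijD q (Fin.cons p.1 p.2 : Fin (R+1) → 𝓧) i j := by
    refine Measurable.mul ?_ ?_
    · exact (measurable_const.indicator (EK_meas hq R Yp K)).comp (meas_cons R)
    · exact Finset.measurable_sum _ fun j _ => (pijD_meas hq i j).comp (meas_cons R)
  exact h.lintegral_prod_right' (ν := Measure.pi fun _ => μ)

lemma glue_eq_cons {R : ℕ} (k : ℕ) (x : ℕ → 𝓧) (v : Fin R → 𝓧) :
    (fun a : Fin (R+1) => glue (k+1) x v (k + a)) = Fin.cons (x k) v := by
  ext a
  refine Fin.cases ?_ (fun a => ?_) a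
  · simp [glue]
  · simp only [Fin.cons_succ, glue, Fin.val_succ]
    have h : k + 1 ≤ k + ((a : ℕ) + 1) ∧ k + ((a : ℕ) + 1) - (k + 1) < R := by omega
    rw [dif_pos h]
    congr 1
    ext; simp; omega

lemma It_Wf_psi {μ : Measure 𝓧} [SigmaFinite μ] {q : 𝓧 × 𝓨 → 𝓧 × 𝓨 → ℝ≥0∞}
    (hq : Measurable (Function.uncurry q)) {R : ℕ} {ψ : (Fin (R+1) → 𝓧) → ℝ≥0∞} (hψ : Measurable ψ)
    (k : ℕ) (x : ℕ → 𝓧) (y : ℕ → 𝓨) :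
    It μ R (k+1) (fun x => Wf q (fun x _ => ψ (fun a : Fin (R+1) => x (k + a))) R k x y) x =
    ∫⁻ v : Fin R → 𝓧, ψ (Fin.cons (x k) v) *
      ∑ j, pijD q (Fin.cons (x k) v : Fin (R+1) → 𝓧) (y k) j ∂(Measure.pi fun _ => μ) := by
  have hm : Measurable (Function.uncurry fun (x : ℕ → 𝓧) (_ : ℕ → 𝓨) =>
      ψ (fun a : Fin (R+1) => x (k + a))) :=
    hψ.comp (by fun_prop)
  rw [It_eq_pi (Wf_meas_x hq hm R k y)]
  refine lintegral_congr fun v => ?_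
  rw [Wf_eq_Mp q (fun x => ψ (fun a : Fin (R+1) => x (k + a)))]
  simp only [← pijD_eq_Mp, glue_eq_cons]

lemma blk {P : Measure Ω} [IsFiniteMeasure P] {Z : ℕ → Ω → 𝓧 × 𝓨} [Nonempty 𝓧]
    {κ : Kernel (𝓧 × 𝓨) (𝓧 × 𝓨)} [IsMarkovKernel κ] {μ : Measure 𝓧} [SigmaFinite μ]
    {q : 𝓧 × 𝓨 → 𝓧 × 𝓨 → ℝ≥0∞} (hq : Measurable (Function.uncurry q))
    (hκ : ∀ z : 𝓧 × 𝓨, (κ z : Measure (𝓧 × 𝓨)) =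
      (μ.prod Measure.count).withDensity (fun z' => q z' z))
    (hM : IsMarkovChain P Z κ) (R : ℕ) (Yp : Set (𝓨 × 𝓨)) (K k : ℕ) (C : Set Ω)
    (hC : MeasurableSet[FF Z k] C) :
    P ({ω | (fun a : Fin (R+1) => (Z (k + a) ω).1) ∈ EK q R Yp K} ∩ C) =
      ∫⁻ ω in C, betaK μ q R Yp K (Z k ω) ∂P := by
  have hE := EK_meas hq R Yp K
  have hmv : Measurable fun ω => fun a : Fin (R+1) => (Z (k + a) ω).1 :=
    measurable_pi_lambda _ fun a => measurable_fst.comp (hM.1 _)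
  have hψ : Measurable ((EK q R Yp K).indicator fun _ => (1 : ℝ≥0∞)) :=
    measurable_const.indicator hE
  have hm : Measurable (Function.uncurry fun (x : ℕ → 𝓧) (_ : ℕ → 𝓨) =>
      (EK q R Yp K).indicator (fun _ => (1 : ℝ≥0∞)) (fun a : Fin (R+1) => x (k + a))) :=
    hψ.comp (by fun_prop)
  have h := S_step (Classical.arbitrary _) hq hκ hM hm R k C hC
  have e1 : ∀ ω, (fun a : Fin (R+1) => (prep (Classical.arbitrary (𝓧 × 𝓨)) Z (k+R) ω (k + a)).1) =
      fun a : Fin (R+1) => (Z (k + a) ω).1 := by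
    intro ω; ext a
    have : k + (a : ℕ) ≤ k + R := by omega
    simp [prep, this]
  simp only [e1, It_Wf_psi hq hψ] at h
  have e2 : ∀ ω, prep (Classical.arbitrary (𝓧 × 𝓨)) Z k ω k = Z k ω := by intro ω; simp [prep]
  simp only [e2] at h
  unfold betaK
  rw [← h]
  have e3 : (fun ω => (EK q R Yp K).indicator (fun _ => (1 : ℝ≥0∞))
      (fun a : Fin (R+1) => (Z (k + a) ω).1)) =
      {ω | (fun a : Fin (R+1) => (Z (k + a) ω).1) ∈ EK q R Yp K}.indicator fun _ => 1 := rfl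
  have hmS : MeasurableSet {ω | (fun a : Fin (R+1) => (Z (k + a) ω).1) ∈ EK q R Yp K} := hmv hE
  rw [e3, lintegral_indicator_const hmS, one_mul, Measure.restrict_apply hmS]

lemma int_pijD {κ : Kernel (𝓧 × 𝓨) (𝓧 × 𝓨)} [IsMarkovKernel κ] {μ : Measure 𝓧} [SigmaFinite μ]
    {q : 𝓧 × 𝓨 → 𝓧 × 𝓨 → ℝ≥0∞} (hq : Measurable (Function.uncurry q))
    (hκ : ∀ z : 𝓧 × 𝓨, (κ z : Measure (𝓧 × 𝓨)) =
      (μ.prod Measure.count).withDensity (fun z' => q z' z)) (R : ℕ) (z : 𝓧 × 𝓨) :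
    ∫⁻ v : Fin R → 𝓧, ∑ j, pijD q (Fin.cons z.1 v : Fin (R+1) → 𝓧) z.2 j
      ∂(Measure.pi fun _ => μ) = 1 := by
  have h := It_Wf_psi (μ := μ) hq (R := R) (ψ := fun _ => 1) measurable_const 0
    (fun _ => z.1) (fun _ => z.2)
  rw [It_Wf_one hq hκ] at h
  simpa using h.symm

lemma betaK_le_one {κ : Kernel (𝓧 × 𝓨) (𝓧 × 𝓨)} [IsMarkovKernel κ] {μ : Measure 𝓧} [SigmaFinite μ]
    {q : 𝓧 × 𝓨 → 𝓧 × 𝓨 → ℝ≥0∞} (hq : Measurable (Function.uncurry q))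
    (hκ : ∀ z : 𝓧 × 𝓨, (κ z : Measure (𝓧 × 𝓨)) =
      (μ.prod Measure.count).withDensity (fun z' => q z' z)) (R : ℕ) (Yp : Set (𝓨 × 𝓨)) (K : ℕ)
    (z : 𝓧 × 𝓨) : betaK μ q R Yp K z ≤ 1 := by
  rw [← int_pijD hq hκ R z]
  refine lintegral_mono fun v => ?_
  by_cases h : (Fin.cons z.1 v : Fin (R+1) → 𝓧) ∈ EK q R Yp K
  · rw [Set.indicator_of_mem h, one_mul]
  · rw [Set.indicator_of_notMem h, zero_mul]; exact zero_le

lemma exists_K {q : 𝓧 × 𝓨 → 𝓧 × 𝓨 → ℝ≥0∞} {R : ℕ} {Yp : Set (𝓨 × 𝓨)} {x : Fin (R+1) → 𝓧}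
    (hx : Yplus q x = Yp) (hfin : ∀ i j, pijD q x i j ≠ ∞) : ∃ K, x ∈ EK q R Yp K := by
  have h1 : ∀ p : 𝓨 × 𝓨, ∃ K : ℕ, ∀ K' ≥ K, (p ∈ Yp → ENNReal.ofReal (1 / ((K' : ℝ) + 1)) ≤ pijD q x p.1 p.2 ∧
    pijD q x p.1 p.2 ≤ ENNReal.ofReal ((K' : ℝ) + 1)) := by
    intro p
    by_cases hp : p ∈ Yp
    · have hpos : 0 < (pijD q x p.1 p.2).toReal := by
        rw [← hx] at hp
        exact ENNReal.toReal_pos hp.ne' (hfin _ _)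
      obtain ⟨K1, hK1⟩ := exists_nat_one_div_lt hpos
      obtain ⟨K2, hK2⟩ := exists_nat_ge (pijD q x p.1 p.2).toReal
      refine ⟨max K1 K2, fun K' hK' _ => ⟨?_, ?_⟩⟩
      · refine (ENNReal.ofReal_le_ofReal ?_).trans ENNReal.ofReal_toReal_le
        refine le_trans ?_ hK1.le
        have : (K1 : ℝ) ≤ K' := by exact_mod_cast (le_max_left _ _).trans hK'
        gcongr
      · refine ENNReal.le_ofReal_iff_toReal_le (hfin _ _) (by positivity) |>.2 ?_
        have : (K2 : ℝ) ≤ K' := by exact_mod_cast (le_max_right _ _).trans hK'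
        linarith
    · exact ⟨0, fun _ _ h => absurd h hp⟩
  choose Kf hKf using h1
  refine ⟨Finset.univ.sup Kf, fun i j => ⟨hKf (i, j) _ (Finset.le_sup (Finset.mem_univ _)), fun h => ?_⟩⟩
  rw [← hx] at h
  exact le_antisymm (not_lt.1 h) zero_le

lemma exists_beta_pos {κ : Kernel (𝓧 × 𝓨) (𝓧 × 𝓨)} [IsMarkovKernel κ] {μ : Measure 𝓧}
    [SigmaFinite μ]
    {q : 𝓧 × 𝓨 → 𝓧 × 𝓨 → ℝ≥0∞} (hq : Measurable (Function.uncurry q))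
    (hκ : ∀ z : 𝓧 × 𝓨, (κ z : Measure (𝓧 × 𝓨)) =
      (μ.prod Measure.count).withDensity (fun z' => q z' z)) {R : ℕ} {E : Set (Fin (R+1) → 𝓧)}
    {Yp : Set (𝓨 × 𝓨)} (hA1 : ∀ x ∈ E, Yplus q x = Yp)
    (hpos : ∀ x₁ ∈ proj1 E, 0 < (Measure.pi fun _ : Fin R => μ) (secSet E x₁))
    (z : 𝓧 × 𝓨) (hz : z ∈ proj1 E ×ˢ (Prod.fst '' Yp)) : ∃ K, betaK μ q R Yp K z ≠ 0 := by
  by_contra hcon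
  push Not at hcon
  have h1 : ∀ K, ∀ᵐ v : Fin R → 𝓧 ∂(Measure.pi fun _ => μ),
      (EK q R Yp K).indicator (fun _ => (1 : ℝ≥0∞)) (Fin.cons z.1 v) *
        ∑ j, pijD q (Fin.cons z.1 v : Fin (R+1) → 𝓧) z.2 j = 0 := by
    intro K
    have hc : Measurable fun v : Fin R → 𝓧 => (Fin.cons z.1 v : Fin (R+1) → 𝓧) :=
      (meas_cons R).comp (measurable_const.prodMk measurable_id)
    refine (lintegral_eq_zero_iff ?_).1 (hcon K)
    refine Measurable.mul ?_ ?_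
    · exact (measurable_const.indicator (EK_meas hq R Yp K)).comp hc
    · exact Finset.measurable_sum _ fun j _ => (pijD_meas hq _ j).comp hc
  have h2 : ∀ i : 𝓨, ∀ᵐ v : Fin R → 𝓧 ∂(Measure.pi fun _ => μ),
      ∑ j, pijD q (Fin.cons z.1 v : Fin (R+1) → 𝓧) i j < ∞ := by
    intro i
    have hc : Measurable fun v : Fin R → 𝓧 => (Fin.cons z.1 v : Fin (R+1) → 𝓧) :=
      (meas_cons R).comp (measurable_const.prodMk measurable_id)
    refine ae_lt_top (Finset.measurable_sum _ fun j _ => (pijD_meas hq _ j).comp hc) ?_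
    rw [int_pijD hq hκ R (z.1, i)]; exact ENNReal.one_ne_top
  have h3 : ∀ᵐ v : Fin R → 𝓧 ∂(Measure.pi fun _ => μ), v ∉ secSet E z.1 := by
    filter_upwards [ae_all_iff.2 h1, ae_all_iff.2 h2] with v hv1 hv2 hvE
    have hY := hA1 _ hvE
    obtain ⟨K, hK⟩ := exists_K hY (fun i j =>
      (ENNReal.sum_lt_top.1 (hv2 i) j (Finset.mem_univ _)).ne)
    have := hv1 K
    rw [Set.indicator_of_mem hK, one_mul, Finset.sum_eq_zero_iff] at this
    obtain ⟨p, hp, hp1⟩ := hz.2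
    have hp0 := this p.2 (Finset.mem_univ _)
    rw [← hY] at hp
    rw [← hp1] at hp0
    exact hp.ne' hp0
  have h4 := hpos z.1 hz.1
  rw [ae_iff] at h3
  simp only [not_not] at h3
  exact h4.ne' h3

lemma blocks_io {P : Measure Ω} [IsProbabilityMeasure P] {Z : ℕ → Ω → 𝓧 × 𝓨} [Nonempty 𝓧]
    [MeasurableSingletonClass 𝓧]
    {κ : Kernel (𝓧 × 𝓨) (𝓧 × 𝓨)} {μ : Measure 𝓧} [SigmaFinite μ]
    {q : 𝓧 × 𝓨 → 𝓧 × 𝓨 → ℝ≥0∞} (hq : Measurable (Function.uncurry q))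
    (hκ : ∀ z : 𝓧 × 𝓨, (κ z : Measure (𝓧 × 𝓨)) =
      (μ.prod Measure.count).withDensity (fun z' => q z' z))
    (hM : IsMarkovChain P Z κ) {Pz : 𝓧 × 𝓨 → Measure (ℕ → 𝓧 × 𝓨)} {ψ : Measure (𝓧 × 𝓨)}
    {R : ℕ} {E : Set (Fin (R + 1) → 𝓧)} {Yp : Set (𝓨 × 𝓨)}
    (hA1 : ∀ x ∈ E, Yplus q x = Yp)
    (hψ : 0 < ψ (proj1 E ×ˢ (Prod.fst '' Yp)))
    (hpos : ∀ x₁ ∈ proj1 E, 0 < (Measure.pi fun _ : Fin R => μ) (secSet E x₁))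
    (hFam : IsMarkovFamily κ Pz) (hHarris : HarrisProp κ Pz ψ) :
    ∃ K, ∀ᵐ ω ∂P, ∀ N, ∃ k, N ≤ k ∧ (fun a : Fin (R+1) => (Z (k + a) ω).1) ∈ EK q R Yp K := by
  have hmk := family_markov hFam
  have hZ := hM.1
  obtain ⟨K, K', hKK⟩ : ∃ K K' : ℕ,
      0 < ψ {z | ENNReal.ofReal (1 / ((K' : ℝ) + 1)) ≤ betaK μ q R Yp K z} := by
    by_contra hcon
    push Not at hcon
    have : ψ (⋃ K : ℕ, ⋃ K' : ℕ, {z | ENNReal.ofReal (1 / ((K' : ℝ) + 1)) ≤ betaK μ q R Yp K z}) = 0 :=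
      measure_iUnion_null fun K => measure_iUnion_null fun K' => le_antisymm (hcon K K') zero_le
    refine hψ.ne' (measure_mono_null (fun z hz => ?_) this)
    obtain ⟨K, hK⟩ := exists_beta_pos hq hκ hA1 hpos z hz
    have hne : betaK μ q R Yp K z ≠ ∞ :=
      ((betaK_le_one hq hκ R Yp K z).trans_lt ENNReal.one_lt_top).ne
    obtain ⟨K', hK'⟩ := exists_nat_one_div_lt (ENNReal.toReal_pos hK hne)
    refine Set.mem_iUnion₂.2 ⟨K, K', ?_⟩
    exact (ENNReal.ofReal_le_ofReal hK'.le).trans ENNReal.ofReal_toReal_le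
  refine ⟨K, ?_⟩
  set A := {z | ENNReal.ofReal (1 / ((K' : ℝ) + 1)) ≤ betaK μ q R Yp K z} with hAdef
  have hA : MeasurableSet A := measurableSet_le measurable_const (betaK_meas hq R Yp K)
  have hvis := visits_io hFam hA (hHarris A hA hKK) hM
  have hE := EK_meas hq R Yp K
  let B : ℕ → Set Ω := fun k => {ω | (fun a : Fin (R+1) => (Z (k + a) ω).1) ∈ EK q R Yp K}
  let ℱ : Filtration ℕ (inferInstance : MeasurableSpace Ω) :=
    ⟨fun n => FF Z n, fun _ _ h => FF_mono Z h, fun n => FF_le hZ n⟩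
  have hBF : ∀ k, MeasurableSet[FF Z (k+R)] (B k) := by
    intro k
    have : Measurable[FF Z (k+R)] fun ω => fun a : Fin (R+1) => (Z (k + a) ω).1 := by
      refine @measurable_pi_lambda _ _ _ (FF Z (k+R)) _ _ fun a => ?_
      exact measurable_fst.comp (FF_meas Z (by omega))
    exact this hE
  have hBm : ∀ k, MeasurableSet (B k) := fun k => FF_le hZ _ _ (hBF k)
  rw [ae_all_iff]
  intro N
  let D : Set Ω := ⋃ k ∈ Set.Ici N, B k
  have hDm : MeasurableSet D := MeasurableSet.biUnion (Set.to_countable _) fun k _ => hBm k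
  have hDF : MeasurableSet[⨆ n, FF Z n] D :=
    MeasurableSet.biUnion (Set.to_countable _) fun k _ =>
      (le_iSup (fun n => FF Z n) (k+R)) _ (hBF k)
  have hle : (⨆ n, FF Z n) ≤ (inferInstance : MeasurableSpace Ω) := iSup_le fun n => FF_le hZ n
  have hlim := tendsto_ae_condExp (μ := P) (ℱ := ℱ) (D.indicator fun _ => (1:ℝ))
  have hIntg : Integrable (D.indicator fun _ => (1:ℝ)) P := (integrable_const 1).indicator hDm
  have hcD : P[D.indicator fun _ => (1:ℝ) | ⨆ n, FF Z n] = D.indicator fun _ => (1:ℝ) :=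
    condExp_of_stronglyMeasurable hle
      ((@stronglyMeasurable_const _ _ (⨆ n, FF Z n) _ (1:ℝ)).indicator hDF) hIntg
  have hn : ∀ n, N ≤ n → (fun ω => (betaK μ q R Yp K (Z n ω)).toReal) ≤ᵐ[P]
      P[D.indicator fun _ => (1:ℝ) | FF Z n] := by
    intro n hn
    have hbm : Measurable[FF Z n] fun ω => betaK μ q R Yp K (Z n ω) :=
      (betaK_meas hq R Yp K).comp (FF_meas Z le_rfl)
    have hbm' : Measurable fun ω => betaK μ q R Yp K (Z n ω) := hbm.mono (FF_le hZ n) le_rfl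
    have hfin : ∀ ω, betaK μ q R Yp K (Z n ω) ≠ ∞ := fun ω =>
      ((betaK_le_one hq hκ R Yp K _).trans_lt ENNReal.one_lt_top).ne
    have hbi : Integrable (fun ω => (betaK μ q R Yp K (Z n ω)).toReal) P := by
      refine Integrable.of_bound (C := 1) hbm'.ennreal_toReal.aestronglyMeasurable
        (Filter.Eventually.of_forall fun ω => ?_)
      rw [Real.norm_of_nonneg ENNReal.toReal_nonneg]
      exact ENNReal.toReal_mono ENNReal.one_ne_top (betaK_le_one hq hκ R Yp K _)
    have hBi : Integrable ((B n).indicator fun _ => (1:ℝ)) P :=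
      (integrable_const 1).indicator (hBm n)
    have h1 : (fun ω => (betaK μ q R Yp K (Z n ω)).toReal) =ᵐ[P]
        P[(B n).indicator fun _ => (1:ℝ) | FF Z n] := by
      refine ae_eq_condExp_of_forall_setIntegral_eq (FF_le hZ n) hBi
        (fun s _ _ => hbi.integrableOn) (fun s hs _ => ?_)
        (hbm.ennreal_toReal.stronglyMeasurable.aestronglyMeasurable)
      rw [integral_toReal hbm'.aemeasurable (Filter.Eventually.of_forall fun ω => (hfin ω).lt_top),
        ← blk hq hκ hM R Yp K n s hs, integral_indicator (hBm n)]
      simp [Measure.restrict_apply (hBm n), measureReal_def, B, Measure.restrict_restrict (hBm n)]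
    have h2 : P[(B n).indicator fun _ => (1:ℝ) | FF Z n] ≤ᵐ[P]
        P[D.indicator fun _ => (1:ℝ) | FF Z n] := by
      refine condExp_mono hBi hIntg (Filter.Eventually.of_forall fun ω => ?_)
      exact Set.indicator_le_indicator_of_subset
        (Set.subset_biUnion_of_mem (u := B) (Set.mem_Ici.2 hn)) (fun _ => zero_le_one) ω
    exact h1.le.trans h2
  have hn' : ∀ᵐ ω ∂P, ∀ n, N ≤ n → (betaK μ q R Yp K (Z n ω)).toReal ≤
      (P[D.indicator fun _ => (1:ℝ) | FF Z n]) ω := by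
    rw [ae_all_iff]; intro n
    by_cases h : N ≤ n
    · filter_upwards [hn n h] with ω hω _ using hω
    · filter_upwards with ω h' using absurd h' h
  filter_upwards [hlim, hn', hvis] with ω h1 h2 h3
  by_contra hcon
  have hωD : ω ∉ D := by
    intro h
    obtain ⟨k, hk, hk2⟩ := Set.mem_iUnion₂.1 h
    exact hcon ⟨k, hk, hk2⟩
  have h4 : Filter.Tendsto (fun n => (P[D.indicator fun _ => (1:ℝ) | FF Z n]) ω) Filter.atTop (nhds 0) := by
    have h5 : (P[D.indicator fun _ => (1:ℝ) | ⨆ n, FF Z n]) ω = 0 := by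
      rw [hcD, Set.indicator_of_notMem hωD]
    rw [← h5]; exact h1
  have hp : (0:ℝ) < 1 / ((K' : ℝ) + 1) := by positivity
  obtain ⟨n0, hn0⟩ := Filter.eventually_atTop.1 (h4.eventually (gt_mem_nhds hp))
  obtain ⟨k, hk, hkA⟩ := h3 (max n0 N)
  have h6 := hn0 k ((le_max_left _ _).trans hk)
  have h7 := h2 k ((le_max_right _ _).trans hk)
  have h8 : 1 / ((K' : ℝ) + 1) ≤ (betaK μ q R Yp K (Z k ω)).toReal :=
    (ENNReal.ofReal_le_iff_le_toReal
      ((betaK_le_one hq hκ R Yp K _).trans_lt ENNReal.one_lt_top).ne).1 hkA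
  linarith

end HelperD

section HelperE

/-- the conditional probability of the tail event given the history up to time `n`. -/
noncomputable def uT (μ : Measure 𝓧) (q : 𝓧 × 𝓨 → 𝓧 × 𝓨 → ℝ≥0∞) (t n e : ℕ) (A : Set (ℕ → 𝓨))
    (x : ℕ → 𝓧) (y : ℕ → 𝓨) : ℝ≥0∞ :=
  It μ e (n+1) (fun x => Wf q (fun _ y => A.indicator (fun _ => 1) (fun k => y (t+k))) e n x y) x

/-- the backward variable. -/
noncomputable def gT (μ : Measure 𝓧) (q : 𝓧 × 𝓨 → 𝓧 × 𝓨 → ℝ≥0∞) (t n e : ℕ) (A : Set (ℕ → 𝓨))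
    (y0 : 𝓨) (x : ℕ → 𝓧) (k : ℕ) (i : 𝓨) : ℝ≥0∞ :=
  Wf q (uT μ q t n e A) (n - k) k x (Function.update (fun _ => y0) k i)

lemma indA_meas {A : Set (ℕ → 𝓨)} (hA : MeasurableSet A) (t : ℕ) :
    Measurable (Function.uncurry fun (_ : ℕ → 𝓧) (y : ℕ → 𝓨) =>
      A.indicator (fun _ => (1 : ℝ≥0∞)) (fun k => y (t+k))) := by
  have h : Measurable fun p : (ℕ → 𝓧) × (ℕ → 𝓨) => fun k => p.2 (t + k) := by fun_prop
  exact (measurable_const.indicator hA).comp h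

lemma uT_meas {μ : Measure 𝓧} [SFinite μ] {q : 𝓧 × 𝓨 → 𝓧 × 𝓨 → ℝ≥0∞}
    (hq : Measurable (Function.uncurry q)) (t n e : ℕ) {A : Set (ℕ → 𝓨)} (hA : MeasurableSet A) :
    Measurable (Function.uncurry (uT μ q t n e A)) :=
  It_meas (Wf_meas hq (indA_meas hA t) e n) e (n+1)

lemma uT_congr {μ : Measure 𝓧} {q : 𝓧 × 𝓨 → 𝓧 × 𝓨 → ℝ≥0∞} {t n e : ℕ} (htn : t ≤ n)
    {A : Set (ℕ → 𝓨)} (x x' : ℕ → 𝓧) (y y' : ℕ → 𝓨) (hx : ∀ a, n ≤ a → x a = x' a)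
    (hy : ∀ a, t ≤ a → y a = y' a) : uT μ q t n e A x y = uT μ q t n e A x' y' := by
  unfold uT
  refine It_congr _ _ n (fun x x' hx => ?_) e (n+1) x x' hx
  refine Wf_congr t e n (fun x x' y y' _ h => ?_) x x' y y' hx (hy n htn) (fun a ha _ => hy a ha)
  have : (fun k => y (t+k)) = fun k => y' (t+k) := by ext k; exact h _ (by omega)
  rw [this]

lemma gT_meas {μ : Measure 𝓧} [SFinite μ] {q : 𝓧 × 𝓨 → 𝓧 × 𝓨 → ℝ≥0∞}
    (hq : Measurable (Function.uncurry q)) (t n e : ℕ) {A : Set (ℕ → 𝓨)} (hA : MeasurableSet A)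
    (y0 : 𝓨) (k : ℕ) (i : 𝓨) : Measurable fun x => gT μ q t n e A y0 x k i :=
  Wf_meas_x hq (uT_meas hq t n e hA) _ _ _

lemma gT_congr {μ : Measure 𝓧} {q : 𝓧 × 𝓨 → 𝓧 × 𝓨 → ℝ≥0∞} {t n e : ℕ} (htn : t ≤ n)
    {A : Set (ℕ → 𝓨)} {y0 : 𝓨} {k : ℕ} (hk : k ≤ n) {i : 𝓨} (x x' : ℕ → 𝓧)
    (hx : ∀ a, k ≤ a → x a = x' a) : gT μ q t n e A y0 x k i = gT μ q t n e A y0 x' k i := by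
  unfold gT
  refine Wf_congr t (n-k) k (fun x x' y y' h1 h2 => ?_) x x' _ _ hx rfl (fun a _ _ => rfl)
  exact uT_congr htn x x' y y' (fun a ha => h1 a (by omega)) h2

lemma gT_rec {μ : Measure 𝓧} {q : 𝓧 × 𝓨 → 𝓧 × 𝓨 → ℝ≥0∞} {t n e : ℕ} (htn : t ≤ n)
    {A : Set (ℕ → 𝓨)} {y0 : 𝓨} {k : ℕ} (hk : k < t) (x : ℕ → 𝓧) (i : 𝓨) :
    gT μ q t n e A y0 x k i = ∑ j, q (x (k+1), j) (x k, i) * gT μ q t n e A y0 x (k+1) j := by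
  unfold gT
  rw [show n - k = (n - (k+1)) + 1 by omega]
  simp only [Wf, Function.update_self]
  refine Finset.sum_congr rfl fun j _ => ?_
  congr 1
  refine Wf_congr t _ (k+1) (fun x x' y y' h1 h2 => ?_) x x _ _ (fun _ _ => rfl) (by simp)
    (fun a ha _ => ?_)
  · exact uT_congr htn x x' y y' (fun a ha => h1 a (by omega)) h2
  · by_cases h : a = k + 1
    · subst h; simp
    · rw [Function.update_of_ne h, Function.update_of_ne h, Function.update_of_ne (by omega)]

lemma gT_mono {μ : Measure 𝓧} {q : 𝓧 × 𝓨 → 𝓧 × 𝓨 → ℝ≥0∞} {t n e : ℕ}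
    {A : Set (ℕ → 𝓨)} {y0 : 𝓨} {k : ℕ} (x : ℕ → 𝓧) (i : 𝓨) :
    gT μ q t n e A y0 x k i ≤ gT μ q t n e Set.univ y0 x k i := by
  refine Wf_mono (fun x y => ?_) _ _ _ _
  refine It_mono (fun x => Wf_mono (fun x y => ?_) _ _ _ _) _ _ _
  exact Set.indicator_le_indicator_of_subset (Set.subset_univ A) (fun _ => zero_le) _

lemma law_ac {P : Measure Ω} [IsProbabilityMeasure P] {Z : ℕ → Ω → 𝓧 × 𝓨}
    {κ : Kernel (𝓧 × 𝓨) (𝓧 × 𝓨)} {μ : Measure 𝓧}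
    {q : 𝓧 × 𝓨 → 𝓧 × 𝓨 → ℝ≥0∞} {p0 : 𝓧 × 𝓨 → ℝ≥0∞}
    (h : IsPMM P Z κ μ q p0) (l : ℕ) : P.map (Z l) ≪ μ.prod Measure.count := by
  obtain ⟨-, hM, -, -, -, hκ, h0⟩ := h
  cases l with
  | zero => rw [h0]; exact withDensity_absolutelyContinuous _ _
  | succ l =>
    refine Measure.AbsolutelyContinuous.mk fun s hs h0 => ?_
    rw [Measure.map_apply (hM.1 _) hs]
    have h1 := hM.2 l (s.indicator fun _ => 1) (measurable_const.indicator hs) Set.univ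
      MeasurableSet.univ
    have h2 : ∀ z, κ z s = 0 := fun z => by
      rw [hκ]; exact withDensity_absolutelyContinuous _ _ h0
    simp only [lintegral_indicator_const hs, h2, mul_zero, lintegral_zero, Measure.restrict_univ] at h1
    have e : (fun ω => s.indicator (fun _ => (1 : ℝ≥0∞)) (Z (l+1) ω)) =
      (Z (l+1) ⁻¹' s).indicator fun _ => 1 := rfl
    rwa [e, lintegral_indicator_const (hM.1 _ hs), one_mul] at h1

/-- a density of `Z_l`. -/
noncomputable def pl (P : Measure Ω) (Z : ℕ → Ω → 𝓧 × 𝓨) (μ : Measure 𝓧) (l : ℕ) :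
    𝓧 × 𝓨 → ℝ≥0∞ := (P.map (Z l)).rnDeriv (μ.prod Measure.count)

lemma int_law {P : Measure Ω} [IsProbabilityMeasure P] {Z : ℕ → Ω → 𝓧 × 𝓨}
    {κ : Kernel (𝓧 × 𝓨) (𝓧 × 𝓨)} {μ : Measure 𝓧}
    {q : 𝓧 × 𝓨 → 𝓧 × 𝓨 → ℝ≥0∞} {p0 : 𝓧 × 𝓨 → ℝ≥0∞}
    (h : IsPMM P Z κ μ q p0) (l : ℕ) {H : 𝓧 × 𝓨 → ℝ≥0∞} (hH : Measurable H) :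
    ∫⁻ ω, H (Z l ω) ∂P = ∫⁻ x', ∑ i, pl P Z μ l (x', i) * H (x', i) ∂μ := by
  have hs : SigmaFinite μ := h.2.2.1
  have hZ := h.2.1.1 l
  rw [← lintegral_map hH hZ, ← Measure.withDensity_rnDeriv_eq _ _ (law_ac h l),
    lintegral_withDensity_eq_lintegral_mul _ (Measure.measurable_rnDeriv _ _) hH,
    lintegral_prod _ ((Measure.measurable_rnDeriv _ _).mul hH).aemeasurable]
  refine lintegral_congr fun x' => ?_
  rw [lintegral_count, tsum_fintype]
  rfl

/-- numerator of the conditional probability. -/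
noncomputable def num (P : Measure Ω) (Z : ℕ → Ω → 𝓧 × 𝓨) (μ : Measure 𝓧)
    (q : 𝓧 × 𝓨 → 𝓧 × 𝓨 → ℝ≥0∞) (t n e l : ℕ) (A : Set (ℕ → 𝓨)) (y0 : 𝓨) (x : ℕ → 𝓧) : ℝ≥0∞ :=
  ∑ i, pl P Z μ l (x l, i) * gT μ q t n e A y0 x l i

lemma num_meas {P : Measure Ω} {Z : ℕ → Ω → 𝓧 × 𝓨} {μ : Measure 𝓧} [SFinite μ]
    {q : 𝓧 × 𝓨 → 𝓧 × 𝓨 → ℝ≥0∞}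
    (hq : Measurable (Function.uncurry q)) (t n e l : ℕ) {A : Set (ℕ → 𝓨)} (hA : MeasurableSet A)
    (y0 : 𝓨) : Measurable (num P Z μ q t n e l A y0) := by
  refine Finset.measurable_sum _ fun i _ => Measurable.mul ?_ (gT_meas hq t n e hA y0 l i)
  exact (Measure.measurable_rnDeriv _ _).comp
    (show Measurable fun x : ℕ → 𝓧 => ((x l, i) : 𝓧 × 𝓨) by fun_prop)

lemma num_congr {P : Measure Ω} {Z : ℕ → Ω → 𝓧 × 𝓨} {μ : Measure 𝓧}
    {q : 𝓧 × 𝓨 → 𝓧 × 𝓨 → ℝ≥0∞} {t n e l : ℕ} (hln : l ≤ n) (htn : t ≤ n) {A : Set (ℕ → 𝓨)}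
    {y0 : 𝓨} (x x' : ℕ → 𝓧) (hx : ∀ a, l ≤ a → x a = x' a) :
    num P Z μ q t n e l A y0 x = num P Z μ q t n e l A y0 x' := by
  unfold num
  refine Finset.sum_congr rfl fun i _ => ?_
  rw [hx l le_rfl, gT_congr htn hln x x' hx]

lemma joint_law (z0 : 𝓧 × 𝓨) {P : Measure Ω} [IsProbabilityMeasure P] {Z : ℕ → Ω → 𝓧 × 𝓨}
    {κ : Kernel (𝓧 × 𝓨) (𝓧 × 𝓨)} [IsMarkovKernel κ] {μ : Measure 𝓧}
    {q : 𝓧 × 𝓨 → 𝓧 × 𝓨 → ℝ≥0∞} {p0 : 𝓧 × 𝓨 → ℝ≥0∞}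
    (h : IsPMM P Z κ μ q p0) {t n l m : ℕ} (hlt : l ≤ t) (htn : t ≤ n) {A : Set (ℕ → 𝓨)}
    (hA : MeasurableSet A) (hAm : ∀ w w' : ℕ → 𝓨, (∀ a, a ≤ m → w a = w' a) → (w ∈ A ↔ w' ∈ A))
    {C' : Set (Fin (n+1-l) → 𝓧)} (hC' : MeasurableSet C') :
    P (obsVec Z l n ⁻¹' C' ∩ tailY Z t ⁻¹' A) =
      ∫⁻ v in C', num P Z μ q t n (t+m) l A z0.2 (glue l (fun _ => z0.1) v)
        ∂(Measure.pi fun _ => μ) := by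
  have h' := h
  obtain ⟨-, hM, hs, hq, -, hκ, -⟩ := h
  have hZ := hM.1
  have hoF : Measurable[FF Z n] (obsVec Z l n) := by
    refine @measurable_pi_lambda _ _ _ (FF Z n) _ _ fun a => ?_
    exact measurable_fst.comp (FF_meas Z (by omega))
  have hom : Measurable (obsVec Z l n) := hoF.mono (FF_le hZ n) le_rfl
  have htm : Measurable (tailY Z t) :=
    measurable_pi_lambda _ fun a => measurable_snd.comp (hZ _)
  set e := t + m with he
  -- first step
  have h1 := S_step z0 hq hκ hM (indA_meas hA t) e n (obsVec Z l n ⁻¹' C') (hoF hC')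
  have e1 : ∀ ω, A.indicator (fun _ => (1 : ℝ≥0∞)) (fun k => (prep z0 Z (n+e) ω (t+k)).2) =
      (tailY Z t ⁻¹' A).indicator (fun _ => 1) ω := by
    intro ω
    have : (fun k => (prep z0 Z (n+e) ω (t+k)).2) ∈ A ↔ ω ∈ tailY Z t ⁻¹' A := by
      refine hAm _ _ fun a ha => ?_
      have : t + a ≤ n + e := by omega
      simp [prep, this, tailY]
    by_cases hw : ω ∈ tailY Z t ⁻¹' A
    · rw [Set.indicator_of_mem hw, Set.indicator_of_mem (this.2 hw)]
    · rw [Set.indicator_of_notMem hw, Set.indicator_of_notMem (fun h => hw (this.1 h))]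
  simp only [e1] at h1
  rw [lintegral_indicator_const (htm hA), one_mul, Measure.restrict_apply (htm hA)] at h1
  rw [Set.inter_comm, h1]
  -- second step
  let c : (ℕ → 𝓧) → ℝ≥0∞ := fun x => C'.indicator (fun _ => 1) (fun i : Fin (n+1-l) => x (l + i))
  have hc : Measurable c := (measurable_const.indicator hC').comp (by fun_prop)
  have hum := uT_meas (μ := μ) hq t n e hA
  have hΨ : Measurable (Function.uncurry fun x y => c x * uT μ q t n e A x y) :=
    (hc.comp measurable_fst).mul hum
  have h2 := S_step z0 hq hκ hM hΨ (n-l) l Set.univ MeasurableSet.univ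
  rw [show l + (n - l) = n by omega] at h2
  simp only [Measure.restrict_univ] at h2
  have e2 : ∀ ω, c (fun a => (prep z0 Z n ω a).1) = (obsVec Z l n ⁻¹' C').indicator (fun _ => 1) ω := by
    intro ω
    have : (fun i : Fin (n+1-l) => (prep z0 Z n ω (l+i)).1) = obsVec Z l n ω := by
      ext i
      have : l + (i : ℕ) ≤ n := by omega
      simp [prep, this, obsVec]
    simp only [c, this]; rfl
  have e3 : ∫⁻ ω in obsVec Z l n ⁻¹' C', It μ e (n+1) (fun x => Wf q
      (fun _ y => A.indicator (fun _ => 1) (fun k => y (t+k))) e n x (fun a => (prep z0 Z n ω a).2))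
      (fun a => (prep z0 Z n ω a).1) ∂P =
      ∫⁻ ω, c (fun a => (prep z0 Z n ω a).1) *
        uT μ q t n e A (fun a => (prep z0 Z n ω a).1) (fun a => (prep z0 Z n ω a).2) ∂P := by
    rw [← lintegral_indicator (hom hC')]
    refine lintegral_congr fun ω => ?_
    rw [e2]
    by_cases hw : ω ∈ obsVec Z l n ⁻¹' C'
    · rw [Set.indicator_of_mem hw, Set.indicator_of_mem hw, one_mul]; rfl
    · rw [Set.indicator_of_notMem hw, Set.indicator_of_notMem hw, zero_mul]
  rw [e3, h2]
  -- function of `Z_l`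
  let H : 𝓧 × 𝓨 → ℝ≥0∞ := fun z => It μ (n-l) (l+1) (fun x => c x * gT μ q t n e A z0.2 x l z.2)
    (Function.update (fun _ => z0.1) l z.1)
  have hF : ∀ i, Measurable fun x => c x * gT μ q t n e A z0.2 x l i := fun i =>
    hc.mul (gT_meas hq t n e hA z0.2 l i)
  have hup : Measurable fun x' : 𝓧 => Function.update (fun _ : ℕ => z0.1) l x' :=
    (meas_update l).comp (measurable_const.prodMk measurable_id)
  have hH : Measurable H := by
    refine measurable_from_prod_countable_left fun i => ?_
    exact (It_meas' (hF i) (n-l) (l+1)).comp hup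
  have e4 : ∀ ω, It μ (n-l) (l+1) (fun x => Wf q (fun x y => c x * uT μ q t n e A x y) (n-l) l x
      (fun a => (prep z0 Z l ω a).2)) (fun a => (prep z0 Z l ω a).1) = H (Z l ω) := by
    intro ω
    simp only [Wf_mul]
    refine It_congr _ _ l (fun x x' hx => ?_) _ _ _ _ (fun a ha => ?_)
    · congr 1
      · simp only [c]; congr 1; ext i; exact hx _ (by omega)
      · unfold gT
        refine Wf_congr t (n-l) l (fun x x' y y' h1 h2 => ?_) x x' _ _ hx (by simp [prep])
          (fun a ha1 ha2 => ?_)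
        · exact uT_congr htn x x' y y' (fun a ha => h1 a (by omega)) h2
        · by_cases hal : a = l
          · subst hal; simp [prep]
          · rw [Function.update_of_ne hal]
            have : ¬ a ≤ l := by omega
            simp [prep, this]
    · by_cases hal : a = l
      · subst hal; simp [prep]
      · rw [Function.update_of_ne hal]
        have : ¬ a ≤ l := by omega
        simp [prep, this]
  simp only [e4]
  rw [int_law h' l hH]
  -- assemble
  have hnm := num_meas (P := P) (Z := Z) (μ := μ) hq t n e l hA z0.2
  have e5 : ∀ x' : 𝓧, ∑ i, pl P Z μ l (x', i) * H (x', i) =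
      It μ (n-l) (l+1) (fun x => c x * num P Z μ q t n e l A z0.2 x)
        (Function.update (fun _ => z0.1) l x') := by
    intro x'
    have hpm : ∀ i, Measurable fun x : ℕ → 𝓧 => pl P Z μ l (x l, i) := fun i =>
      (Measure.measurable_rnDeriv _ _).comp
        (show Measurable fun x : ℕ → 𝓧 => ((x l, i) : 𝓧 × 𝓨) by fun_prop)
    have e6 : (fun x => c x * num P Z μ q t n e l A z0.2 x) = fun x => ∑ i,
        pl P Z μ l (x l, i) * (c x * gT μ q t n e A z0.2 x l i) := by
      ext x
      simp only [num, Finset.mul_sum]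
      exact Finset.sum_congr rfl fun i _ => by ring
    rw [e6]
    rw [It_sum (F := fun i x => pl P Z μ l (x l, i) * (c x * gT μ q t n e A z0.2 x l i))
      (fun i => (hpm i).mul (hF i))]
    refine Finset.sum_congr rfl fun i _ => ?_
    rw [It_mul (hF i) (fun x => pl P Z μ l (x l, i))]
    · simp [H]
    · intro x a v ha
      rw [Function.update_of_ne (by omega)]
  simp only [e5]
  have e7 : ∫⁻ x', It μ (n-l) (l+1) (fun x => c x * num P Z μ q t n e l A z0.2 x)
        (Function.update (fun _ => z0.1) l x') ∂μ =
      It μ (n+1-l) l (fun x => c x * num P Z μ q t n e l A z0.2 x) (fun _ => z0.1) := by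
    rw [show n + 1 - l = (n - l) + 1 by omega]; rfl
  rw [e7, It_eq_pi (F := fun x => c x * num P Z μ q t n e l A z0.2 x) (hc.mul hnm), ← lintegral_indicator hC']
  refine lintegral_congr fun v => ?_
  have e8 : c (glue l (fun _ => z0.1) v) = C'.indicator (fun _ => 1) v := by
    simp only [c]
    congr 1
    ext i
    have : l ≤ l + (i : ℕ) ∧ l + (i : ℕ) - l < n + 1 - l := by omega
    simp [glue]
  rw [e8]
  by_cases hv : v ∈ C'
  · rw [Set.indicator_of_mem hv, Set.indicator_of_mem hv, one_mul]
  · rw [Set.indicator_of_notMem hv, Set.indicator_of_notMem hv, zero_mul]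

lemma cond_formula (z0 : 𝓧 × 𝓨) {P : Measure Ω} [IsProbabilityMeasure P] {Z : ℕ → Ω → 𝓧 × 𝓨}
    {κ : Kernel (𝓧 × 𝓨) (𝓧 × 𝓨)} [IsMarkovKernel κ] {μ : Measure 𝓧}
    {q : 𝓧 × 𝓨 → 𝓧 × 𝓨 → ℝ≥0∞} {p0 : 𝓧 × 𝓨 → ℝ≥0∞}
    (h : IsPMM P Z κ μ q p0) {t n l m : ℕ} (hlt : l ≤ t) (htn : t ≤ n) {A : Set (ℕ → 𝓨)}
    (hA : MeasurableSet A) (hAm : ∀ w w' : ℕ → 𝓨, (∀ a, a ≤ m → w a = w' a) → (w ∈ A ↔ w' ∈ A)) :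
    ∀ᵐ ω ∂P, 
      num P Z μ q t n (t+m) l Set.univ z0.2 (fun a => (prep z0 Z n ω a).1) *
        condLawTail P Z t l n ω A =
        num P Z μ q t n (t+m) l A z0.2 (fun a => (prep z0 Z n ω a).1) ∧
      num P Z μ q t n (t+m) l Set.univ z0.2 (fun a => (prep z0 Z n ω a).1) ≠ 0 ∧
      num P Z μ q t n (t+m) l Set.univ z0.2 (fun a => (prep z0 Z n ω a).1) ≠ ∞ := by
  have h' := h
  obtain ⟨-, hM, hs, hq, -, hκ, -⟩ := h
  have hZ := hM.1
  have hom : Measurable (obsVec Z l n) := 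
    measurable_pi_lambda _ fun a => measurable_fst.comp (hZ _)
  have htm : Measurable (tailY Z t) :=
    measurable_pi_lambda _ fun a => measurable_snd.comp (hZ _)
  let π : Measure (Fin (n+1-l) → 𝓧) := Measure.pi fun _ => μ
  let den : (Fin (n+1-l) → 𝓧) → ℝ≥0∞ := fun v =>
    num P Z μ q t n (t+m) l Set.univ z0.2 (glue l (fun _ => z0.1) v)
  let nu : (Fin (n+1-l) → 𝓧) → ℝ≥0∞ := fun v =>
    num P Z μ q t n (t+m) l A z0.2 (glue l (fun _ => z0.1) v)
  have hden : Measurable den := (num_meas hq t n (t+m) l MeasurableSet.univ z0.2).comp (glue_meas _ _)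
  have hnu : Measurable nu := (num_meas hq t n (t+m) l hA z0.2).comp (glue_meas _ _)
  have hlaw : P.map (obsVec Z l n) = π.withDensity den := by
    ext C' hC'
    rw [Measure.map_apply hom hC', withDensity_apply _ hC']
    have := joint_law z0 h' hlt htn (m := m) MeasurableSet.univ (fun _ _ _ => Iff.rfl) hC'
    rw [Set.preimage_univ, Set.inter_univ] at this
    exact this
  let cd : (Fin (n+1-l) → 𝓧) → ℝ≥0∞ := fun v => condDistrib (tailY Z t) (obsVec Z l n) P v A
  have hcd : Measurable cd := Kernel.measurable_coe _ hA
  have h1 : (den * cd) =ᵐ[π] nu := by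
    refine ae_eq_of_forall_setLIntegral_eq_of_sigmaFinite (hden.mul hcd) hnu fun C' hC' _ => ?_
    rw [← setLIntegral_withDensity_eq_setLIntegral_mul _ hden hcd hC', ← hlaw,
      setLIntegral_map hC' hcd hom]
    rw [setLIntegral_preimage_condDistrib hom htm.aemeasurable hA hC']
    exact joint_law z0 h' hlt htn hA hAm hC'
  have h2 : ∀ᵐ v ∂π, den v < ∞ := by
    refine ae_lt_top hden ?_
    have : ∫⁻ v, den v ∂π = 1 := by
      rw [← setLIntegral_univ, ← withDensity_apply _ MeasurableSet.univ, ← hlaw,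
        Measure.map_apply hom MeasurableSet.univ]
      simp
    rw [this]; exact ENNReal.one_ne_top
  have h3 : ∀ᵐ v ∂(P.map (obsVec Z l n)), den v * cd v = nu v ∧ den v ≠ 0 ∧ den v ≠ ∞ := by
    rw [hlaw, ae_withDensity_iff hden]
    filter_upwards [h1, h2] with v hv1 hv2 hv3 using ⟨hv1, hv3, hv2.ne⟩
  have h4 := ae_of_ae_map hom.aemeasurable h3
  filter_upwards [h4] with ω hω
  have hpath : ∀ a, l ≤ a → glue l (fun _ => z0.1) (obsVec Z l n ω) a = (prep z0 Z n ω a).1 := by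
    intro a ha
    by_cases han : a ≤ n
    · have : l ≤ a ∧ a - l < n + 1 - l := by omega
      simp only [glue, this, and_self, dif_pos, prep, han, if_true, obsVec]
      rw [show l + (a - l) = a by omega]
    · have : ¬ (l ≤ a ∧ a - l < n + 1 - l) := by omega
      simp only [glue, this, dif_neg, not_false_eq_true, prep, han, if_false]
  have hc : ∀ A', num P Z μ q t n (t+m) l A' z0.2 (glue l (fun _ => z0.1) (obsVec Z l n ω)) =
      num P Z μ q t n (t+m) l A' z0.2 (fun a => (prep z0 Z n ω a).1) := fun A' =>
    num_congr (hlt.trans htn) htn _ _ hpath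
  rw [← hc, ← hc]
  exact hω

end HelperE

lemma le_of_cyl {ρ₁ ρ₂ : Measure (ℕ → 𝓨)} [IsProbabilityMeasure ρ₁] [IsProbabilityMeasure ρ₂]
    {δ : ℝ≥0∞}
    (h : ∀ (m : ℕ) (D : Set ((i : Finset.Iic m) → 𝓨)),
      ρ₁ (cylinder (α := fun _ : ℕ => 𝓨) (Finset.Iic m) D) ≤
        ρ₂ (cylinder (α := fun _ : ℕ => 𝓨) (Finset.Iic m) D) + δ)
    {A : Set (ℕ → 𝓨)} (hA : MeasurableSet A) : ρ₁ A ≤ ρ₂ A + δ := by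
  refine ENNReal.le_of_forall_pos_le_add fun ε hε _ => ?_
  have hε' : (0 : ℝ≥0∞) < ε := by exact_mod_cast hε
  obtain ⟨C, hC, hlt⟩ := exists_measure_symmDiff_lt_of_generateFrom_isSetRing (μ := ρ₁ + ρ₂)
    (C := measurableCylinders (fun _ : ℕ => 𝓨)) isSetRing_measurableCylinders
    ⟨{Set.univ}, Set.countable_singleton _,
      Set.singleton_subset_iff.2 (univ_mem_measurableCylinders _), by simp⟩
    generateFrom_measurableCylinders.symm hA hε'
  rw [measurableCylinders_nat] at hC
  simp only [Set.mem_iUnion, Set.mem_singleton_iff] at hC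
  obtain ⟨m, D, -, rfl⟩ := hC
  set C := cylinder (α := fun _ : ℕ => 𝓨) (Finset.Iic m) D with hCdef
  have h1 : ρ₁ A ≤ ρ₁ C + ρ₁ (symmDiff C A) := by
    refine (measure_mono ?_).trans (measure_union_le _ _)
    intro w hw
    by_cases hwC : w ∈ C
    · exact Or.inl hwC
    · exact Or.inr (Or.inr ⟨hw, hwC⟩)
  have h2 : ρ₂ C ≤ ρ₂ A + ρ₂ (symmDiff C A) := by
    refine (measure_mono ?_).trans (measure_union_le _ _)
    intro w hw
    by_cases hwC : w ∈ A
    · exact Or.inl hwC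
    · exact Or.inr (Or.inl ⟨hw, hwC⟩)
  have h3 := h m D
  rw [← hCdef] at h3
  calc ρ₁ A ≤ (ρ₂ A + ρ₂ (symmDiff C A) + δ) + ρ₁ (symmDiff C A) := by
        refine h1.trans ?_
        gcongr
        exact h3.trans (by gcongr)
    _ = ρ₂ A + δ + (ρ₁ + ρ₂) (symmDiff C A) := by
        rw [Measure.add_apply]; ring
    _ ≤ ρ₂ A + δ + ε := by gcongr

lemma tv_le_of_cyl {ρ₁ ρ₂ : Measure (ℕ → 𝓨)} [IsProbabilityMeasure ρ₁] [IsProbabilityMeasure ρ₂]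
    {δ : ℝ≥0∞}
    (h : ∀ (m : ℕ) (D : Set ((i : Finset.Iic m) → 𝓨)),
      ρ₁ (cylinder (α := fun _ : ℕ => 𝓨) (Finset.Iic m) D) ≤
        ρ₂ (cylinder (α := fun _ : ℕ => 𝓨) (Finset.Iic m) D) + δ ∧
      ρ₂ (cylinder (α := fun _ : ℕ => 𝓨) (Finset.Iic m) D) ≤
        ρ₁ (cylinder (α := fun _ : ℕ => 𝓨) (Finset.Iic m) D) + δ) :
    tvDistM ρ₁ ρ₂ ≤ 2 * δ := by
  unfold tvDistM
  gcongr
  refine iSup₂_le fun A hA => sup_le ?_ ?_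
  · rw [tsub_le_iff_left]
    exact le_of_cyl (fun m D => (h m D).1) hA
  · rw [tsub_le_iff_left]
    exact le_of_cyl (fun m D => (h m D).2) hA

instance condLawTail_prob {P : Measure Ω} [IsFiniteMeasure P] {Z : ℕ → Ω → 𝓧 × 𝓨} {t l n : ℕ}
    {ω : Ω} : IsProbabilityMeasure (condLawTail P Z t l n ω) := by
  unfold condLawTail; infer_instance

lemma cond_bound {b g p : 𝓨 → ℝ≥0∞} {c d : ℝ} {r : ℝ≥0∞} (h : Osc b g c d)
    (he : (∑ i, p i * b i) * r = ∑ i, p i * g i) (h0 : ∑ i, p i * b i ≠ 0)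
    (hT : ∑ i, p i * b i ≠ ∞) : ENNReal.ofReal c ≤ r ∧ r ≤ ENNReal.ofReal d := by
  obtain ⟨h1, h2⟩ := osc_final h hT
  rw [← he, mul_comm] at h1
  rw [← he, mul_comm (ENNReal.ofReal d)] at h2
  exact ⟨(ENNReal.mul_le_mul_iff_right h0 hT).1 h1, (ENNReal.mul_le_mul_iff_right h0 hT).1 h2⟩

/-- Corollary 1 (i). If the PMM `Z` satisfies **A1**, **A2** and is Harris
recurrent, then for all fixed `l ≤ s`, almost surely
`lim_t sup_{n ≥ t} ‖P(Y_{t:∞} ∈ · | X_{l:n}) − P(Y_{t:∞} ∈ · | X_{s:n})‖_TV = 0`,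
where the conditional distributions are regular versions on the cylindrical σ-algebra
of `𝓨^∞`. -/
theorem forgetting_of_tail_distributions
    [TopologicalSpace 𝓧] [PolishSpace 𝓧] [BorelSpace 𝓧]
    (P : Measure Ω) [IsProbabilityMeasure P]
    (Z : ℕ → Ω → 𝓧 × 𝓨) (κ : Kernel (𝓧 × 𝓨) (𝓧 × 𝓨)) (μ : Measure 𝓧)
    (q : 𝓧 × 𝓨 → 𝓧 × 𝓨 → ℝ≥0∞) (p0 : 𝓧 × 𝓨 → ℝ≥0∞)
    (Pz : 𝓧 × 𝓨 → Measure (ℕ → 𝓧 × 𝓨)) (ψ : Measure (𝓧 × 𝓨))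
    {R : ℕ} (E : Set (Fin (R + 1) → 𝓧)) (Yp : Set (𝓨 × 𝓨))
    (hPMM : IsPMM P Z κ μ q p0)
    (hA1 : Assumption1 q E Yp) (hA2 : Assumption2 κ ψ μ E Yp)
    (hFam : IsMarkovFamily κ Pz) (hHarris : HarrisProp κ Pz ψ) :
    ∀ l s : ℕ, ∀ᵐ ω ∂P, ∀ ε : ℝ≥0∞, 0 < ε → ∃ T : ℕ, ∀ t, T ≤ t → l ≤ t → s ≤ t →
      ∀ n, t ≤ n →
        tvDistM (condLawTail P Z t l n ω) (condLawTail P Z t s n ω) ≤ ε := by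
  intro l s
  have hPMM' := hPMM
  obtain ⟨-, hM, hσ, hq, -, hκ, -⟩ := hPMM'
  have hmk : IsMarkovKernel κ := family_markov hFam
  obtain ⟨ω₀⟩ : Nonempty Ω := nonempty_of_isProbabilityMeasure P
  have hne : Nonempty 𝓧 := ⟨(Z 0 ω₀).1⟩
  have z0 : 𝓧 × 𝓨 := Z 0 ω₀
  obtain ⟨-, -, hA1', hprod⟩ := hA1
  obtain ⟨K, hK⟩ := blocks_io hq hκ hM hA1' hA2.2.1 hA2.2.2 hFam hHarris
  have hform : ∀ l : ℕ, ∀ᵐ ω ∂P, ∀ t n m : ℕ, ∀ D : Set ((i : Finset.Iic m) → 𝓨),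
      l ≤ t → t ≤ n →
      num P Z μ q t n (t+m) l Set.univ z0.2 (fun a => (prep z0 Z n ω a).1) *
        condLawTail P Z t l n ω (cylinder (α := fun _ : ℕ => 𝓨) (Finset.Iic m) D) =
        num P Z μ q t n (t+m) l (cylinder (α := fun _ : ℕ => 𝓨) (Finset.Iic m) D) z0.2
          (fun a => (prep z0 Z n ω a).1) ∧
      num P Z μ q t n (t+m) l Set.univ z0.2 (fun a => (prep z0 Z n ω a).1) ≠ 0 ∧
      num P Z μ q t n (t+m) l Set.univ z0.2 (fun a => (prep z0 Z n ω a).1) ≠ ∞ := by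
    intro l
    refine ae_all_iff.2 fun t => ae_all_iff.2 fun n => ae_all_iff.2 fun m => ae_all_iff.2 fun D => ?_
    by_cases hl : l ≤ t
    · by_cases hn : t ≤ n
      · have hmeas : MeasurableSet (cylinder (α := fun _ : ℕ => 𝓨) (Finset.Iic m) D) :=
          MeasurableSet.cylinder _ (Set.toFinite D).measurableSet
        filter_upwards [cond_formula z0 hPMM hl hn (m := m) hmeas (by
          intro w w' hww
          have e : (Finset.Iic m).restrict w = (Finset.Iic m).restrict w' := by
            ext a
            exact hww a (Finset.mem_Iic.1 a.2)
          rw [mem_cylinder, mem_cylinder, e])] with ω hω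
        exact fun _ _ => hω
      · exact Filter.Eventually.of_forall fun ω _ h => absurd h hn
    · exact Filter.Eventually.of_forall fun ω h => absurd h hl
  filter_upwards [hK, hform l, hform s] with ω hB hfl hfs
  intro ε hε
  set KR : ℝ := (K : ℝ) + 1 with hKR
  have hKR1 : 1 ≤ KR := by
    have : (0 : ℝ) ≤ K := Nat.cast_nonneg K
    linarith
  have hr0 : 0 ≤ 1 - 1 / KR ^ 2 := by
    have : 1 / KR ^ 2 ≤ 1 := by
      rw [div_le_one (by positivity)]
      exact one_le_pow₀ hKR1
    linarith
  have hr1 : 1 - 1 / KR ^ 2 < 1 := by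
    have : 0 < 1 / KR ^ 2 := by positivity
    linarith
  obtain ⟨N, hN⟩ : ∃ N : ℕ, 2 * ENNReal.ofReal ((1 - 1 / KR ^ 2) ^ N) ≤ ε := by
    have h1 : Filter.Tendsto (fun N : ℕ => 2 * ENNReal.ofReal ((1 - 1 / KR ^ 2) ^ N)) Filter.atTop
        (nhds (2 * ENNReal.ofReal 0)) :=
      ENNReal.Tendsto.const_mul
        (ENNReal.tendsto_ofReal (tendsto_pow_atTop_nhds_zero_of_lt_one hr0 hr1))
        (Or.inr (by simp))
    have h2 : (2 * ENNReal.ofReal 0) < ε := by simpa using hε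
    obtain ⟨N, hN⟩ := (h1.eventually (gt_mem_nhds h2)).exists
    exact ⟨N, hN.le⟩
  obtain ⟨T, hT⟩ := exists_blocks (R := R) hB N (max l s)
  refine ⟨T, fun t hTt hlt hst n htn => (tv_le_of_cyl fun m D => ?_).trans hN⟩
  set x : ℕ → 𝓧 := fun a => (prep z0 Z n ω a).1 with hx
  set A := cylinder (α := fun _ : ℕ => 𝓨) (Finset.Iic m) D
  have hb : ∀ k, k < t → ∀ i, gT μ q t n (t+m) Set.univ z0.2 x k i =
      ∑ j, (fun k i j => q (x (k+1), j) (x k, i)) k i j *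
        gT μ q t n (t+m) Set.univ z0.2 x (k+1) j := fun k hk i => gT_rec htn hk x i
  have hg : ∀ k, k < t → ∀ i, gT μ q t n (t+m) A z0.2 x k i =
      ∑ j, (fun k i j => q (x (k+1), j) (x k, i)) k i j *
        gT μ q t n (t+m) A z0.2 x (k+1) j := fun k hk i => gT_rec htn hk x i
  obtain ⟨c, d, hcd, hosc⟩ := osc_blocks (b := gT μ q t n (t+m) Set.univ z0.2 x)
    (g := gT μ q t n (t+m) A z0.2 x) hb hg (fun i => gT_mono x i) hKR1
    (Y1 := Prod.fst '' Yp) (Y2 := Prod.snd '' Yp)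
    (B := fun k => (fun a : Fin (R+1) => (Z (k + a) ω).1) ∈ EK q R Yp K) (R := R) (by
      intro k hk hBk
      have hxe : (fun a : Fin (R+1) => (Z (k + a) ω).1) = fun a : Fin (R+1) => x (k + a) := by
        funext a
        have : k + (a : ℕ) ≤ n := by have := a.2; omega
        simp only [hx, prep, if_pos this]
      rw [hxe] at hBk
      have hmem : ∀ i j, (i, j) ∈ Yp ↔ (i ∈ Prod.fst '' Yp ∧ j ∈ Prod.snd '' Yp) := by
        intro i j
        conv_lhs => rw [hprod]
        exact Set.mem_prod
      refine ⟨fun i hi j hj => ?_, fun i j hij => ?_⟩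
      · rw [← pijD_eq_Mp]
        exact (hBk i j).1 ((hmem i j).2 ⟨hi, hj⟩)
      · rw [← pijD_eq_Mp]
        exact (hBk i j).2 (fun h => hij ((hmem i j).1 h))) N (max l s) (hT t hTt)
  have hms : max l s ≤ t := max_le hlt hst
  have ol := osc_down hb hg (le_max_left l s) hms hosc
  have os := osc_down hb hg (le_max_right l s) hms hosc
  obtain ⟨l1, l2, l3⟩ := hfl t n m D hlt htn
  obtain ⟨s1, s2, s3⟩ := hfs t n m D hst htn
  obtain ⟨bl1, bl2⟩ := cond_bound ol l1 l2 l3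
  obtain ⟨bs1, bs2⟩ := cond_bound os s1 s2 s3
  have hd : ENNReal.ofReal d ≤ ENNReal.ofReal c + ENNReal.ofReal ((1 - 1 / KR ^ 2) ^ N) := by
    rw [← hcd]
    refine le_trans (ENNReal.ofReal_le_ofReal (by linarith)) ENNReal.ofReal_add_le
  exact ⟨bl2.trans (hd.trans (by gcongr)), bs2.trans (hd.trans (by gcongr))⟩

end PMMPaper
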